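/- arXiv:0901.4613 — 9 statements merged into one kernel-verified Lean document; each statement's English description precedes it below -/
import Mathlib

section
/- Let T > 0 and K > 0. For s ∈ (0,T), let Λ(K,s) denote the unique positive root of the equation x = K + x^{s/T}. Then Λ(K,s) is strictly increasing in s: if 0 < s₁ < s₂ < T, then Λ(K,s₁) < Λ(K,s₂). -/
/-- A positive solution of `x = K + x ^ a` with `K > 0` and `a ≤ 1` exceeds `1`. -/
theorem one_lt_of_eq_add_rpow {K a x : ℝ} (hK : 0 < K) (ha : a ≤ 1) (hx : 0 < x)
    (h : x = K + x ^ a) : 1 < x := by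
  by_contra! hx1
  have := Real.rpow_le_rpow_of_exponent_ge hx hx1 ha
  rw [Real.rpow_one] at this
  linarith

/-- For `0 ≤ a ≤ 1`, the function `x ↦ x - x ^ a` is monotone on `[1, ∞)`. -/
theorem sub_rpow_monotoneOn {a : ℝ} (ha₀ : 0 ≤ a) (ha₁ : a ≤ 1) :
    MonotoneOn (fun x : ℝ => x - x ^ a) (Set.Ici 1) := by
  have factor : ∀ x : ℝ, 1 ≤ x → x - x ^ a = x ^ a * (x ^ (1 - a) - 1) := fun x hx => by
    rw [mul_sub, ← Real.rpow_add (by linarith), add_sub_cancel, Real.rpow_one, mul_one]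
  intro y hy x hx hyx
  have hy : 1 ≤ y := hy
  have hx : 1 ≤ x := hx
  have hy₀ : 0 ≤ y := by linarith
  have hy' : 1 ≤ y ^ (1 - a) := Real.one_le_rpow hy (by linarith)
  change y - y ^ a ≤ x - x ^ a
  rw [factor y hy, factor x hx]
  exact mul_le_mul (Real.rpow_le_rpow hy₀ hyx ha₀)
    (sub_le_sub_right (Real.rpow_le_rpow hy₀ hyx (by linarith)) 1)
    (by linarith) (Real.rpow_nonneg (by linarith) a)

/-- The unique positive root `Λ(K,s)` of `x = K + x ^ (s/T)` is strictly increasing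
in `s`: if `0 < s₁ < s₂ < T` then `Λ(K,s₁) < Λ(K,s₂)`. -/
theorem root_strictMono_in_s
    (T K s₁ s₂ Λ₁ Λ₂ : ℝ) (hT : 0 < T) (hK : 0 < K)
    (hs₁ : 0 < s₁) (h₁₂ : s₁ < s₂) (hs₂ : s₂ < T)
    (hΛ₁ : 0 < Λ₁) (hΛ₂ : 0 < Λ₂)
    (hroot₁ : Λ₁ = K + Λ₁ ^ (s₁ / T)) (hroot₂ : Λ₂ = K + Λ₂ ^ (s₂ / T)) :
    Λ₁ < Λ₂ := by
  have h₂ : s₂ / T ≤ 1 := ((div_lt_one hT).2 hs₂).le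
  have hlt : s₁ / T < s₂ / T := div_lt_div_of_pos_right h₁₂ hT
  have hΛ₂_gt : 1 < Λ₂ := one_lt_of_eq_add_rpow hK h₂ hΛ₂ hroot₂
  by_contra! hle
  have hmono : Λ₂ - Λ₂ ^ (s₁ / T) ≤ Λ₁ - Λ₁ ^ (s₁ / T) :=
    sub_rpow_monotoneOn (div_pos hs₁ hT).le (hlt.le.trans h₂)
      hΛ₂_gt.le (hΛ₂_gt.le.trans hle) hle
  have hexp := Real.rpow_lt_rpow_of_exponent_lt hΛ₂_gt hlt
  linarith
end

section
/- Let T > 0 and let δ, M, K > 0 satisfy K + 1 < M/δ. Define s* = T·log(M/δ − K)/log(M/δ). Then for every s with 0 < s < s*, the unique positive root Λ = Λ(K,s) of the equation x = K + x^{s/T} satisfies K + 1 < Λ < M/δ. -/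
/-- For `0 < s < s* = T·log(M/δ − K)/log(M/δ)`, the unique positive root `Λ` of
`x = K + x ^ (s/T)` satisfies `K + 1 < Λ < M/δ`. -/
theorem root_between_Kadd1_and_M_div_delta
    (T δ M K s Λ : ℝ) (hT : 0 < T) (hδ : 0 < δ) (hM : 0 < M) (hK : 0 < K)
    (h : K + 1 < M / δ)
    (hs : 0 < s) (hss : s < T * Real.log (M / δ - K) / Real.log (M / δ))
    (hΛ : 0 < Λ) (hroot : Λ = K + Λ ^ (s / T)) :
    K + 1 < Λ ∧ Λ < M / δ := by
  have hA : 1 < M / δ := by linarith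
  have hA0 : 0 < M / δ := by linarith
  have hlog : 0 < Real.log (M / δ) := Real.log_pos hA
  have ha : 0 < s / T := div_pos hs hT
  have hexp : s / T * Real.log (M / δ) < Real.log (M / δ - K) := by
    rw [lt_div_iff₀ hlog] at hss
    rw [div_mul_eq_mul_div, div_lt_iff₀ hT]
    linarith
  have hlt : (M / δ) ^ (s / T) < M / δ - K := by
    rwa [Real.rpow_def_of_pos hA0, mul_comm, ← Real.lt_log_iff_exp_lt (by linarith)]
  have ha1 : s / T < 1 := by
    rw [← Real.rpow_lt_rpow_left_iff hA, Real.rpow_one]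
    linarith
  have hΛ1 : 1 < Λ := by
    by_contra! hle
    have := Real.rpow_le_rpow_of_exponent_ge hΛ hle ha1.le
    rw [Real.rpow_one] at this
    linarith
  refine ⟨by linarith [Real.one_lt_rpow hΛ1 ha], ?_⟩
  by_contra! hge
  obtain ⟨t, rfl⟩ : ∃ t, Λ = M / δ * t := ⟨Λ / (M / δ), (mul_div_cancel₀ Λ hA0.ne').symm⟩
  have ht : 1 ≤ t := (le_mul_iff_one_le_right hA0).mp hge
  have ht0 : 0 < t := by linarith
  have hta : t ^ (s / T) ≤ t := by
    simpa using Real.rpow_le_rpow_of_exponent_le ht ha1.le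
  rw [Real.mul_rpow hA0.le ht0.le] at hroot
  have h1 : (M / δ) ^ (s / T) * t ^ (s / T) ≤ (M / δ) ^ (s / T) * t := by gcongr
  have h2 : (M / δ) ^ (s / T) * t < (M / δ - K) * t := by gcongr
  nlinarith
end

section
/- Let T > 0, let λ : ℕ → ℝ satisfy λ_n > 0 for all n, and let (c_n) be a real sequence with ∑_n c_n² e^{2λ_n T} < ∞. Then for every t ∈ [0, T], ∑_n c_n² e^{2λ_n t} ≤ (∑_n c_n² e^{2λ_n T})^{t/T} · (∑_n c_n²)^{1 − t/T}. Equivalently, if z(t) = ∑_n c_n e^{λ_n t} φ_n for an orthonormal family (φ_n) in a real Hilbert space, then ‖z(t)‖ ≤ ‖z(T)‖^{t/T} ‖z(0)‖^{1 − t/T} for all t ∈ [0,T]. -/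
/-- **Hölder inequality** for series, in its log-convex form. -/
theorem Real.tsum_rpow_mul_rpow_one_sub_le {ι : Type*} {f g : ι → ℝ} {θ : ℝ}
    (h0 : 0 ≤ θ) (h1 : θ ≤ 1) (hf : ∀ i, 0 ≤ f i) (hg : ∀ i, 0 ≤ g i)
    (hf_sum : Summable f) (hg_sum : Summable g) :
    ∑' i, f i ^ θ * g i ^ (1 - θ) ≤ (∑' i, f i) ^ θ * (∑' i, g i) ^ (1 - θ) := by
  rcases h0.eq_or_lt with rfl | h0
  · simp
  rcases h1.eq_or_lt with rfl | h1
  · simp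
  have h1' : 0 < 1 - θ := sub_pos.2 h1
  have hpq : (θ⁻¹).HolderConjugate (1 - θ)⁻¹ := by
    rw [Real.holderConjugate_iff]
    exact ⟨(one_lt_inv₀ h0).2 h1, by simp⟩
  have hfp (i) : (f i ^ θ) ^ θ⁻¹ = f i := Real.rpow_rpow_inv (hf i) h0.ne'
  have hgp (i) : (g i ^ (1 - θ)) ^ (1 - θ)⁻¹ = g i := Real.rpow_rpow_inv (hg i) h1'.ne'
  have key := Real.inner_le_Lp_mul_Lq_tsum_of_nonneg hpq
    (fun i => Real.rpow_nonneg (hf i) θ) (fun i => Real.rpow_nonneg (hg i) (1 - θ))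
    (by simpa only [hfp] using hf_sum) (by simpa only [hgp] using hg_sum)
  simpa only [hfp, hgp, one_div, inv_inv] using key

/-- Hölder-type interpolation inequality for spectral series: for `t ∈ [0,T]`,
`‖z(t)‖² = ∑ cₙ² e^{2λₙ t} ≤ (∑ cₙ² e^{2λₙ T})^{t/T} (∑ cₙ²)^{1−t/T}`. -/
theorem holder_interpolation_of_spectral_series
    (T : ℝ) (hT : 0 < T)
    (lam : ℕ → ℝ) (hlam : ∀ n, 0 < lam n)
    (c : ℕ → ℝ) (hsum : Summable (fun n => c n ^ 2 * Real.exp (2 * lam n * T))) :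
    ∀ t ∈ Set.Icc (0 : ℝ) T,
      (∑' n, c n ^ 2 * Real.exp (2 * lam n * t)) ≤
        (∑' n, c n ^ 2 * Real.exp (2 * lam n * T)) ^ (t / T) *
          (∑' n, c n ^ 2) ^ (1 - t / T) := by
  rintro t ⟨ht0, htT⟩
  have hsum0 : Summable fun n => c n ^ 2 := by
    refine hsum.of_nonneg_of_le (fun n => sq_nonneg _) fun n => ?_
    have := hlam n
    exact le_mul_of_one_le_right (sq_nonneg _) (Real.one_le_exp (by positivity))
  have hterm (n) : c n ^ 2 * Real.exp (2 * lam n * t) =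
      (c n ^ 2 * Real.exp (2 * lam n * T)) ^ (t / T) * (c n ^ 2) ^ (1 - t / T) := by
    have hexp : 2 * lam n * T * (t / T) = 2 * lam n * t := by field_simp
    rw [Real.mul_rpow (sq_nonneg _) (Real.exp_pos _).le, ← Real.exp_mul, hexp,
      mul_right_comm ((c n ^ 2) ^ (t / T)),
      ← Real.rpow_add' (sq_nonneg _) (by simp), add_sub_cancel, Real.rpow_one]
  simp_rw [hterm]
  exact Real.tsum_rpow_mul_rpow_one_sub_le (by positivity) ((div_le_one hT).2 htT)
    (fun n => by positivity) (fun n => sq_nonneg _) hsum hsum0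
end

section
/- Let T > 0, 0 < s < T, δ > 0, K > 0. Let λ : ℕ → ℝ be a nondecreasing sequence with λ_n > 0 for all n and λ_n → ∞, and let (z_n) be a real sequence with ∑_n z_n² e^{2λ_n T} < ∞. Assume ∑_n z_n² (e^{λ_n T} − e^{λ_n s})² ≤ (2Kδ)². Then ∑_n z_n² e^{2λ_n s} ≤ (2Kδ/(T − s))² + ∑_{n : λ_n < 1} z_n² (1 − λ_n²) e^{2λ_n s}, where the last sum ranges over the (finitely many) indices n with λ_n < 1. -/
/-- The convexity bound `1 + x ≤ eˣ`, in the form of a lower bound for `e^{lT} − e^{ls}`. -/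
lemma sq_mul_exp_le_exp_sub_exp_sq {l s T : ℝ} (hl : 0 ≤ l) (hsT : s ≤ T) :
    (l * (T - s)) ^ 2 * Real.exp (2 * l * s) ≤ (Real.exp (l * T) - Real.exp (l * s)) ^ 2 := by
  have hT : Real.exp (l * T) = Real.exp (l * s) * Real.exp (l * (T - s)) := by
    rw [← Real.exp_add]; ring_nf
  have hs : Real.exp (2 * l * s) = Real.exp (l * s) ^ 2 := by
    rw [← Real.exp_nat_mul]; push_cast; ring_nf
  rw [hs, ← mul_pow]
  have hx : 0 ≤ l * (T - s) := mul_nonneg hl (sub_nonneg.2 hsT)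
  refine pow_le_pow_left₀ (by positivity) ?_ 2
  rw [hT]
  nlinarith [Real.exp_pos (l * s), Real.add_one_le_exp (l * (T - s))]

/-- The difference of exponentials is dominated by the larger one. -/
lemma exp_sub_exp_sq_le {l s T : ℝ} (hl : 0 ≤ l) (hsT : s ≤ T) :
    (Real.exp (l * T) - Real.exp (l * s)) ^ 2 ≤ Real.exp (2 * l * T) := by
  have hT : Real.exp (2 * l * T) = Real.exp (l * T) ^ 2 := by
    rw [← Real.exp_nat_mul]; push_cast; ring_nf
  have hle : Real.exp (l * s) ≤ Real.exp (l * T) := by gcongr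
  rw [hT]
  exact pow_le_pow_left₀ (sub_nonneg.2 hle) (by linarith [Real.exp_pos (l * s)]) 2


/-- The bound on `‖z(s)‖²` obtained from the SECB constraint
`∑ zₙ² (e^{λₙ T} − e^{λₙ s})² ≤ (2Kδ)²`:
`∑ zₙ² e^{2λₙ s} ≤ (2Kδ/(T−s))² + ∑_{λₙ < 1} zₙ² (1 − λₙ²) e^{2λₙ s}`. -/
theorem norm_sq_at_s_bound
    (T s δ K : ℝ) (hT : 0 < T) (hs : 0 < s) (hsT : s < T) (hδ : 0 < δ) (hK : 0 < K)
    (lam : ℕ → ℝ) (hmono : Monotone lam) (hpos : ∀ n, 0 < lam n)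
    (hto : Filter.Tendsto lam Filter.atTop Filter.atTop)
    (z : ℕ → ℝ) (hsum : Summable (fun n => z n ^ 2 * Real.exp (2 * lam n * T)))
    (hsecb : (∑' n, z n ^ 2 * (Real.exp (lam n * T) - Real.exp (lam n * s)) ^ 2) ≤
      (2 * K * δ) ^ 2) :
    (∑' n, z n ^ 2 * Real.exp (2 * lam n * s)) ≤
      (2 * K * δ / (T - s)) ^ 2 +
        ∑' n : {n : ℕ // lam n < 1},
          z n.1 ^ 2 * (1 - lam n.1 ^ 2) * Real.exp (2 * lam n.1 * s) := by
  have hc : 0 < T - s := sub_pos.2 hsT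
  have hsum_s : Summable fun n => z n ^ 2 * Real.exp (2 * lam n * s) := by
    refine Summable.of_nonneg_of_le (fun n => by positivity) (fun n => ?_) hsum
    have := (hpos n).le
    gcongr
  have hsum_diff : Summable fun n =>
      z n ^ 2 * (Real.exp (lam n * T) - Real.exp (lam n * s)) ^ 2 :=
    Summable.of_nonneg_of_le (fun n => by positivity)
      (fun n => mul_le_mul_of_nonneg_left (exp_sub_exp_sq_le (hpos n).le hsT.le)
        (sq_nonneg _)) hsum
  set low : ℕ → ℝ := Set.indicator {n | lam n < 1}
    fun n => z n ^ 2 * (1 - lam n ^ 2) * Real.exp (2 * lam n * s) with hlow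
  have hsum_low : Summable low := by
    refine Summable.of_nonneg_of_le (fun n => ?_) (fun n => ?_) hsum_s
    · refine Set.indicator_nonneg (fun m (hm : lam m < 1) => ?_) n
      have : 0 ≤ 1 - lam m ^ 2 := by nlinarith [hpos m]
      positivity
    · refine Set.indicator_apply_le' (fun _ => ?_) (fun _ => by positivity)
      have := sq_nonneg (lam n)
      gcongr
      exact mul_le_of_le_one_right (sq_nonneg _) (by linarith)
  have hsubtype : (∑' n : {n : ℕ // lam n < 1},
      z n.1 ^ 2 * (1 - lam n.1 ^ 2) * Real.exp (2 * lam n.1 * s)) = ∑' n, low n :=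
    tsum_subtype {n | lam n < 1}
      fun n => z n ^ 2 * (1 - lam n ^ 2) * Real.exp (2 * lam n * s)
  have hterm (n : ℕ) : z n ^ 2 * Real.exp (2 * lam n * s) ≤
      z n ^ 2 * (Real.exp (lam n * T) - Real.exp (lam n * s)) ^ 2 / (T - s) ^ 2 + low n := by
    have hmain : z n ^ 2 * (lam n ^ 2 * Real.exp (2 * lam n * s)) ≤
        z n ^ 2 * (Real.exp (lam n * T) - Real.exp (lam n * s)) ^ 2 / (T - s) ^ 2 := by
      rw [mul_div_assoc]
      refine mul_le_mul_of_nonneg_left ?_ (sq_nonneg _)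
      rw [le_div_iff₀ (by positivity)]
      linarith [sq_mul_exp_le_exp_sub_exp_sq (hpos n).le hsT.le]
    by_cases hn : lam n < 1
    · rw [hlow, Set.indicator_of_mem (by exact hn)]
      linarith
    · rw [hlow, Set.indicator_of_notMem (by exact hn), add_zero]
      refine le_trans ?_ hmain
      gcongr
      exact le_mul_of_one_le_left (Real.exp_pos _).le (one_le_pow₀ (not_lt.1 hn))
  calc
    _ ≤ ∑' n, (z n ^ 2 * (Real.exp (lam n * T) - Real.exp (lam n * s)) ^ 2 / (T - s) ^ 2
          + low n) := hsum_s.tsum_le_tsum hterm ((hsum_diff.div_const _).add hsum_low)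
    _ = (∑' n, z n ^ 2 * (Real.exp (lam n * T) - Real.exp (lam n * s)) ^ 2) / (T - s) ^ 2
          + ∑' n, low n := by
      rw [(hsum_diff.div_const _).tsum_add hsum_low, tsum_div_const]
    _ ≤ _ := by
      rw [hsubtype, div_pow]
      gcongr
end

section
/- Let H be a real Hilbert space, (φ_n)_{n∈ℕ} an orthonormal family in H, and λ : ℕ → ℝ a nondecreasing sequence with λ_n > 0 for all n and λ_n → ∞. Let T > 0, 0 < s < T, δ > 0, K > 0, and g ∈ H. For j = 1, 2 let c^j : ℕ → ℝ satisfy ∑_n (c^j_n)² e^{2λ_n T} < ∞ and define u_j(t) = ∑_n c^j_n e^{λ_n t} φ_n for t ∈ [0, T]. Assume ‖u_j(0) − g‖ ≤ δ and ‖u_j(T) − u_j(s)‖ ≤ Kδ for j = 1, 2. Then for every t ∈ [0, T], ‖u_1(t) − u_2(t)‖ ≤ 2 Λ^{t/T} δ, where Λ is the unique positive root of the equation x = K + x^{s/T}. -/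
/-- Parseval's identity for a square-summable expansion in an orthonormal family. -/
theorem Orthonormal.hasSum_sq_norm_tsum {ι H : Type*} [NormedAddCommGroup H]
    [InnerProductSpace ℝ H] [CompleteSpace H] {φ : ι → H} (hφ : Orthonormal ℝ φ)
    {a : ι → ℝ} (ha : Summable fun n => a n ^ 2) :
    Summable (fun n => a n • φ n) ∧ HasSum (fun n => a n ^ 2) (‖∑' n, a n • φ n‖ ^ 2) := by
  have hs : Summable (fun n => a n • φ n) := by
    have h := (hφ.orthogonalFamily.summable_iff_norm_sq_summable a).2 (by simpa using ha)
    simpa using h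
  refine ⟨hs, (hs.hasSum.norm.pow 2).congr fun s => ?_⟩
  simpa using hφ.orthogonalFamily.norm_sum a s

/-- The coefficients of a spectral solution remain square summable at all earlier times. -/
theorem summable_sq_mul_exp_of_le {ι : Type*} {lam d : ι → ℝ} (hlam : ∀ n, 0 ≤ lam n) {t T : ℝ}
    (htT : t ≤ T) (hd : Summable fun n => d n ^ 2 * Real.exp (2 * lam n * T)) :
    Summable fun n => (d n * Real.exp (lam n * t)) ^ 2 := by
  refine hd.of_nonneg_of_le (fun n => sq_nonneg _) fun n => ?_
  rw [mul_pow, ← Real.exp_nat_mul]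
  have := mul_le_mul_of_nonneg_left htT (hlam n)
  refine mul_le_mul_of_nonneg_left (Real.exp_le_exp.2 ?_) (sq_nonneg _)
  push_cast
  linarith

/-- Logarithmic convexity of the norm of a spectral solution. -/
theorem Orthonormal.norm_tsum_exp_le {ι H : Type*} [NormedAddCommGroup H]
    [InnerProductSpace ℝ H] [CompleteSpace H] {φ : ι → H} (hφ : Orthonormal ℝ φ)
    {lam d : ι → ℝ} (hlam : ∀ n, 0 ≤ lam n) {t T : ℝ} (ht : 0 ≤ t) (htT : t ≤ T) (hT : 0 < T)
    (hd : Summable fun n => d n ^ 2 * Real.exp (2 * lam n * T)) :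
    ‖∑' n, (d n * Real.exp (lam n * t)) • φ n‖ ≤
      ‖∑' n, (d n * Real.exp (lam n * 0)) • φ n‖ ^ (1 - t / T) *
        ‖∑' n, (d n * Real.exp (lam n * T)) • φ n‖ ^ (t / T) := by
  rcases ht.eq_or_lt with rfl | ht
  · simp
  rcases htT.eq_or_lt with rfl | htT
  · simp [hT.ne']
  have parseval (r : ℝ) (hr : r ≤ T) :=
    (hφ.hasSum_sq_norm_tsum (summable_sq_mul_exp_of_le hlam hr hd)).2
  set W : ℝ → ℝ := fun r => ‖∑' n, (d n * Real.exp (lam n * r)) • φ n‖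
  change W t ≤ W 0 ^ (1 - t / T) * W T ^ (t / T)
  have hW (r : ℝ) : 0 ≤ W r := norm_nonneg _
  set θ := t / T with hθ
  have hθ0 : 0 < θ := div_pos ht hT
  have hθ1 : θ < 1 := (div_lt_one hT).2 htT
  have rpow_sq_rpow_inv (x y : ℝ) (hy : y ≠ 0) : ((x ^ 2) ^ y) ^ y⁻¹ = x ^ 2 :=
    Real.rpow_rpow_inv (sq_nonneg x) hy
  obtain ⟨C, -, hC, hsum⟩ := Real.inner_le_Lp_mul_Lq_hasSum_of_nonneg
    (Real.HolderConjugate.inv_one_sub_inv hθ0 hθ1).symm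
    (A := (W 0 ^ 2) ^ (1 - θ)) (B := (W T ^ 2) ^ θ)
    (f := fun n => ((d n * Real.exp (lam n * 0)) ^ 2) ^ (1 - θ))
    (g := fun n => ((d n * Real.exp (lam n * T)) ^ 2) ^ θ)
    (by positivity) (by positivity) (fun n => by positivity) (fun n => by positivity)
    (by
      simp_rw [rpow_sq_rpow_inv _ _ (sub_pos.2 hθ1).ne']
      exact parseval 0 hT.le)
    (by
      simp_rw [rpow_sq_rpow_inv _ _ hθ0.ne']
      exact parseval T le_rfl)
  have hterm (n : ι) : ((d n * Real.exp (lam n * 0)) ^ 2) ^ (1 - θ) *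
      ((d n * Real.exp (lam n * T)) ^ 2) ^ θ = (d n * Real.exp (lam n * t)) ^ 2 := by
    have hexp : (Real.exp (lam n * T) ^ 2) ^ θ = Real.exp (lam n * t) ^ 2 := by
      rw [← Real.exp_nat_mul, ← Real.exp_nat_mul, ← Real.exp_mul, hθ]
      congr 1
      field_simp
    have hsplit : (d n ^ 2) ^ (1 - θ) * (d n ^ 2) ^ θ = d n ^ 2 := by
      rw [← Real.rpow_add_of_nonneg (sq_nonneg _) (sub_pos.2 hθ1).le hθ0.le, sub_add_cancel,
        Real.rpow_one]
    rw [mul_zero, Real.exp_zero, mul_one, mul_pow (d n), mul_pow (d n),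
      Real.mul_rpow (sq_nonneg _) (sq_nonneg _), hexp, ← mul_assoc, hsplit]
  simp_rw [hterm] at hsum
  rw [hsum.unique (parseval t htT.le), ← Real.rpow_pow_comm (hW 0),
    ← Real.rpow_pow_comm (hW T), ← mul_pow] at hC
  exact le_of_sq_le_sq hC (by positivity)

/-- A subsolution of `x = K + x ^ p` with `p ≤ 1` lies below every positive solution. -/
theorem le_of_le_add_rpow {K p x Λ : ℝ} (hK : 0 < K) (hp : p ≤ 1) (hΛ : 0 < Λ)
    (hroot : Λ = K + Λ ^ p) (hx : x ≤ K + x ^ p) : x ≤ Λ := by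
  by_contra! h
  set r := x / Λ with hr
  have hr1 : 1 < r := (one_lt_div hΛ).2 h
  have hxr : x = r * Λ := by rw [hr]; field_simp
  have hrp : r ^ p ≤ r := by
    simpa using Real.rpow_le_rpow_of_exponent_le hr1.le hp
  rw [hxr, Real.mul_rpow (by linarith) hΛ.le] at hx
  have h1 : r ^ p * Λ ^ p ≤ r * Λ ^ p := by gcongr
  have h2 : r * Λ = r * K + r * Λ ^ p := by rw [← mul_add, ← hroot]
  nlinarith

/-- Main theorem (the a priori bound `‖uⱼ(T)‖ ≤ M` is redundant): two spectral
solutions of the backward parabolic problem satisfying `‖uⱼ(0) − g‖ ≤ δ` and the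
SECB constraint `‖uⱼ(T) − uⱼ(s)‖ ≤ Kδ` satisfy
`‖u₁(t) − u₂(t)‖ ≤ 2 Λ^{t/T} δ` for all `t ∈ [0,T]`, where `Λ` is the unique
positive root of `x = K + x^{s/T}`. -/
theorem secb_stability_without_apriori_bound
    {H : Type*} [NormedAddCommGroup H] [InnerProductSpace ℝ H] [CompleteSpace H]
    (φ : ℕ → H) (hφ : Orthonormal ℝ φ)
    (lam : ℕ → ℝ) (hmono : Monotone lam) (hpos : ∀ n, 0 < lam n)
    (hto : Filter.Tendsto lam Filter.atTop Filter.atTop)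
    (T s δ K Λ : ℝ) (hT : 0 < T) (hs : 0 < s) (hsT : s < T) (hδ : 0 < δ) (hK : 0 < K)
    (hΛ : 0 < Λ) (hroot : Λ = K + Λ ^ (s / T))
    (g : H) (c₁ c₂ : ℕ → ℝ)
    (hsum₁ : Summable (fun n => c₁ n ^ 2 * Real.exp (2 * lam n * T)))
    (hsum₂ : Summable (fun n => c₂ n ^ 2 * Real.exp (2 * lam n * T)))
    (u₁ u₂ : ℝ → H)
    (hu₁ : ∀ t, u₁ t = ∑' n, (c₁ n * Real.exp (lam n * t)) • φ n)
    (hu₂ : ∀ t, u₂ t = ∑' n, (c₂ n * Real.exp (lam n * t)) • φ n)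
    (hinit₁ : ‖u₁ 0 - g‖ ≤ δ) (hinit₂ : ‖u₂ 0 - g‖ ≤ δ)
    (hsecb₁ : ‖u₁ T - u₁ s‖ ≤ K * δ) (hsecb₂ : ‖u₂ T - u₂ s‖ ≤ K * δ) :
    ∀ t ∈ Set.Icc (0 : ℝ) T, ‖u₁ t - u₂ t‖ ≤ 2 * Λ ^ (t / T) * δ := by
  have hlam (n : ℕ) : 0 ≤ lam n := (hpos n).le
  have hd : Summable fun n => (c₁ n - c₂ n) ^ 2 * Real.exp (2 * lam n * T) := by
    refine ((hsum₁.add hsum₂).mul_left 2).of_nonneg_of_le (fun n => by positivity) fun n => ?_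
    rw [← add_mul, ← mul_assoc]
    gcongr
    nlinarith [sq_nonneg (c₁ n + c₂ n)]
  have hdiff (r : ℝ) (hr : r ≤ T) :
      u₁ r - u₂ r = ∑' n, ((c₁ n - c₂ n) * Real.exp (lam n * r)) • φ n := by
    rw [hu₁, hu₂, ← Summable.tsum_sub
      (hφ.hasSum_sq_norm_tsum (summable_sq_mul_exp_of_le hlam hr hsum₁)).1
      (hφ.hasSum_sq_norm_tsum (summable_sq_mul_exp_of_le hlam hr hsum₂)).1]
    simp_rw [sub_mul, sub_smul]
  have logconvex (r : ℝ) (hr : 0 ≤ r) (hrT : r ≤ T) :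
      ‖u₁ r - u₂ r‖ ≤ ‖u₁ 0 - u₂ 0‖ ^ (1 - r / T) * ‖u₁ T - u₂ T‖ ^ (r / T) := by
    rw [hdiff r hrT, hdiff 0 hT.le, hdiff T le_rfl]
    exact hφ.norm_tsum_exp_le hlam hr hrT hT hd
  have h0 : ‖u₁ 0 - u₂ 0‖ ≤ 2 * δ := by
    have := norm_sub_le (u₁ 0 - g) (u₂ 0 - g)
    rw [sub_sub_sub_cancel_right] at this
    linarith
  have hTs : ‖u₁ T - u₂ T‖ ≤ 2 * K * δ + ‖u₁ s - u₂ s‖ := by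
    have h1 := norm_sub_le (u₁ T - u₁ s) (u₂ T - u₂ s)
    have h2 := norm_add_le ((u₁ T - u₁ s) - (u₂ T - u₂ s)) (u₁ s - u₂ s)
    rw [show (u₁ T - u₁ s) - (u₂ T - u₂ s) + (u₁ s - u₂ s) = u₁ T - u₂ T by abel] at h2
    linarith
  obtain ⟨x, hx⟩ : ∃ x, ‖u₁ T - u₂ T‖ = 2 * δ * x :=
    ⟨‖u₁ T - u₂ T‖ / (2 * δ), by field_simp⟩
  have hx0 : 0 ≤ x := nonneg_of_mul_nonneg_right (hx ▸ norm_nonneg _) (by positivity)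
  have interp (r : ℝ) (hr : 0 ≤ r) (hrT : r ≤ T) :
      ‖u₁ r - u₂ r‖ ≤ 2 * δ * x ^ (r / T) := by
    have h1 : 0 ≤ 1 - r / T := sub_nonneg.2 ((div_le_one hT).2 hrT)
    calc ‖u₁ r - u₂ r‖ ≤ (2 * δ) ^ (1 - r / T) * (2 * δ * x) ^ (r / T) := by
          rw [← hx]
          exact (logconvex r hr hrT).trans (by gcongr)
      _ = 2 * δ * x ^ (r / T) := by
          rw [Real.mul_rpow (by positivity) hx0, ← mul_assoc, ← Real.rpow_add (by positivity),
            sub_add_cancel, Real.rpow_one]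
  have hxΛ : x ≤ Λ := by
    refine le_of_le_add_rpow hK ((div_le_one hT).2 hsT.le) hΛ hroot ?_
    have := interp s hs.le hsT.le
    refine le_of_mul_le_mul_left ?_ (show 0 < 2 * δ by positivity)
    linarith
  intro t ⟨ht, htT⟩
  calc ‖u₁ t - u₂ t‖ ≤ 2 * δ * x ^ (t / T) := interp t ht htT
    _ ≤ 2 * δ * Λ ^ (t / T) := by gcongr
    _ = 2 * Λ ^ (t / T) * δ := by ring
end

section
/- Let H be a real Hilbert space, (φ_n)_{n∈ℕ} an orthonormal family in H, and λ : ℕ → ℝ a nondecreasing sequence with λ_n > 0 for all n and λ_n → ∞. Let T > 0, δ > 0, M > 0, K > 0 with K + 1 < M/δ, let s* = T·log(M/δ − K)/log(M/δ), and let 0 < s < s*. Let g ∈ H. For j = 1, 2 let c^j : ℕ → ℝ satisfy ∑_n (c^j_n)² e^{2λ_n T} < ∞ and define u_j(t) = ∑_n c^j_n e^{λ_n t} φ_n for t ∈ [0, T]. Assume ‖u_j(0) − g‖ ≤ δ, ‖u_j(T)‖ ≤ M, and ‖u_j(T) − u_j(s)‖ ≤ Kδ for j = 1, 2. Then for every t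 ∈ [0, T], ‖u_1(t) − u_2(t)‖ ≤ 2 Λ^{t/T} δ, where Λ is the unique positive root of the equation x = K + x^{s/T}, and this Λ satisfies Λ < M/δ. -/
section AuxiliaryLemmas

variable {H : Type*} [NormedAddCommGroup H] [InnerProductSpace ℝ H]

theorem Orthonormal.summable_smul_of_summable_sq [CompleteSpace H] {ι : Type*} {φ : ι → H}
    (hφ : Orthonormal ℝ φ) {a : ι → ℝ} (ha : Summable fun n => a n ^ 2) :
    Summable fun n => a n • φ n := by
  have h := hφ.orthogonalFamily.summable_iff_norm_sq_summable (f := a)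
  simp only [LinearIsometry.toSpanSingleton_apply, Real.norm_eq_abs, sq_abs] at h
  exact h.2 ha

theorem Orthonormal.hasSum_sq_of_hasSum_smul {ι : Type*} {φ : ι → H} (hφ : Orthonormal ℝ φ)
    {a : ι → ℝ} {x : H} (hx : HasSum (fun n => a n • φ n) x) :
    HasSum (fun n => a n ^ 2) (‖x‖ ^ 2) := by
  classical
  have hcoeff : ∀ m, inner ℝ x (φ m) = a m := fun m => by
    have h := hx.mapL (innerSL ℝ (φ m))
    have h' := hasSum_single (f := fun n => innerSL ℝ (φ m) (a n • φ n)) m fun n hn => by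
      simp [hφ.2 hn.symm]
    have h'' := h.unique h'
    simp only [innerSL_apply_apply, inner_smul_right, real_inner_self_eq_norm_sq, hφ.1 m] at h''
    rw [real_inner_comm, h'']
    ring
  have h := hx.mapL (innerSL ℝ x)
  simp only [innerSL_apply_apply, inner_smul_right, hcoeff, real_inner_self_eq_norm_sq] at h
  simpa only [sq] using h

theorem summable_mul_exp_of_le {c lam : ℕ → ℝ} (hpos : ∀ n, 0 < lam n) {t T : ℝ} (ht : t ≤ T)
    (hsum : Summable fun n => c n ^ 2 * Real.exp (2 * lam n * T)) :
    Summable fun n => (c n * Real.exp (lam n * t)) ^ 2 := by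
  refine Summable.of_nonneg_of_le (fun n => sq_nonneg _) (fun n => ?_) hsum
  rw [mul_pow, ← Real.exp_nat_mul]
  refine mul_le_mul_of_nonneg_left (Real.exp_le_exp.2 ?_) (sq_nonneg _)
  have := mul_le_mul_of_nonneg_left ht (hpos n).le
  push_cast
  linarith

/-- Logarithmic convexity of the weighted sums `∑ dₙ² e^{2λₙt}` in `t`. -/
theorem le_rpow_mul_rpow_of_hasSum_exp {d lam : ℕ → ℝ} {T t a b x y z : ℝ} (hT : 0 < T)
    (ht : t ∈ Set.Icc (0 : ℝ) T) (ha : 0 < a) (hb : 0 < b)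
    (hz : 0 ≤ z) (hxa : x ^ 2 ≤ a ^ 2) (hyb : y ^ 2 ≤ b ^ 2)
    (hx : HasSum (fun n => (d n * Real.exp (lam n * 0)) ^ 2) (x ^ 2))
    (hy : HasSum (fun n => (d n * Real.exp (lam n * T)) ^ 2) (y ^ 2))
    (hzs : HasSum (fun n => (d n * Real.exp (lam n * t)) ^ 2) (z ^ 2)) :
    z ≤ a ^ (1 - t / T) * b ^ (t / T) := by
  set θ := t / T with hθ
  have hθ0 : 0 ≤ θ := div_nonneg ht.1 hT.le
  have hθ1 : θ ≤ 1 := (div_le_one hT).2 ht.2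
  have htθ : t = θ * T := by rw [hθ]; field_simp
  set C := a ^ (1 - θ) * b ^ θ with hC
  have hC0 : 0 < C := by positivity
  have hterm : ∀ n, (d n * Real.exp (lam n * t)) ^ 2 ≤
      C ^ 2 * ((1 - θ) / a ^ 2 * (d n * Real.exp (lam n * 0)) ^ 2 +
        θ / b ^ 2 * (d n * Real.exp (lam n * T)) ^ 2) := fun n => by
    have hamgm := Real.geom_mean_le_arith_mean2_weighted (sub_nonneg.2 hθ1) hθ0
      (p₁ := (1 / a) ^ 2) (p₂ := (Real.exp (lam n * T) / b) ^ 2)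
      (by positivity) (by positivity) (by ring)
    have hexp : Real.exp (lam n * t) = Real.exp (lam n * T) ^ θ := by
      rw [← Real.exp_mul, htθ]; ring_nf
    have hgeom : Real.exp (lam n * t) ^ 2 =
        C ^ 2 * (((1 / a) ^ 2) ^ (1 - θ) * ((Real.exp (lam n * T) / b) ^ 2) ^ θ) := by
      rw [hexp, hC, ← Real.rpow_pow_comm (by positivity), ← Real.rpow_pow_comm (by positivity),
        Real.div_rpow (by positivity) (by positivity),
        Real.div_rpow (by positivity) (by positivity), Real.one_rpow]
      field_simp
    rw [mul_pow, hgeom]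
    calc d n ^ 2 * (C ^ 2 * (((1 / a) ^ 2) ^ (1 - θ) * ((Real.exp (lam n * T) / b) ^ 2) ^ θ))
        ≤ d n ^ 2 * (C ^ 2 * ((1 - θ) * (1 / a) ^ 2 + θ * (Real.exp (lam n * T) / b) ^ 2)) := by
          gcongr
      _ = _ := by
          simp only [mul_zero, Real.exp_zero]
          field_simp
  have hle := hasSum_le hterm hzs
    (((hx.mul_left ((1 - θ) / a ^ 2)).add (hy.mul_left (θ / b ^ 2))).mul_left (C ^ 2))
  have hone : (1 - θ) / a ^ 2 * x ^ 2 + θ / b ^ 2 * y ^ 2 ≤ 1 := by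
    have h1 : (1 - θ) / a ^ 2 * x ^ 2 ≤ (1 - θ) / a ^ 2 * a ^ 2 :=
      mul_le_mul_of_nonneg_left hxa (div_nonneg (sub_nonneg.2 hθ1) (by positivity))
    have h2 : θ / b ^ 2 * y ^ 2 ≤ θ / b ^ 2 * b ^ 2 :=
      mul_le_mul_of_nonneg_left hyb (by positivity)
    rw [div_mul_cancel₀ _ (by positivity)] at h1 h2
    linarith
  refine (sq_le_sq₀ hz hC0.le).1 ?_
  nlinarith [sq_nonneg C]

/-- A point `x` with `x ≤ K + x ^ p` is at most any `y` with `K + y ^ p ≤ y`. -/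
theorem le_of_le_add_rpow_s10 {K p x y : ℝ} (hK : 0 < K) (hp : p ≤ 1) (hy : 0 < y)
    (hxp : x ≤ K + x ^ p) (hyp : K + y ^ p ≤ y) : x ≤ y := by
  by_contra! hlt
  have hr : 1 < x / y := (one_lt_div hy).2 hlt
  have hx : x = x / y * y := by field_simp
  have hpow : x ^ p = (x / y) ^ p * y ^ p := by
    rw [← Real.mul_rpow (by positivity) hy.le, ← hx]
  have hle : (x / y) ^ p ≤ x / y := by
    simpa using Real.rpow_le_rpow_of_exponent_le hr.le hp
  have hyp0 : 0 ≤ y ^ p := by positivity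
  nlinarith [mul_le_mul_of_nonneg_right hle hyp0]

end AuxiliaryLemmas

/-- Carasso's SECB stability theorem: two spectral solutions of the backward
parabolic problem satisfying `‖uⱼ(0) − g‖ ≤ δ`, `‖uⱼ(T)‖ ≤ M` and the SECB
constraint `‖uⱼ(T) − uⱼ(s)‖ ≤ Kδ` with `0 < s < s*` satisfy
`‖u₁(t) − u₂(t)‖ ≤ 2 Λ^{t/T} δ` for all `t ∈ [0,T]`, where `Λ` is the unique
positive root of `x = K + x^{s/T}` and `Λ < M/δ`. -/
theorem carasso_secb_stability
    {H : Type*} [NormedAddCommGroup H] [InnerProductSpace ℝ H] [CompleteSpace H]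
    (φ : ℕ → H) (hφ : Orthonormal ℝ φ)
    (lam : ℕ → ℝ) (hmono : Monotone lam) (hpos : ∀ n, 0 < lam n)
    (hto : Filter.Tendsto lam Filter.atTop Filter.atTop)
    (T δ M K s Λ : ℝ) (hT : 0 < T) (hδ : 0 < δ) (hM : 0 < M) (hK : 0 < K)
    (hMδ : K + 1 < M / δ)
    (hs : 0 < s) (hss : s < T * Real.log (M / δ - K) / Real.log (M / δ))
    (hΛ : 0 < Λ) (hroot : Λ = K + Λ ^ (s / T))
    (g : H) (c₁ c₂ : ℕ → ℝ)
    (hsum₁ : Summable (fun n => c₁ n ^ 2 * Real.exp (2 * lam n * T)))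
    (hsum₂ : Summable (fun n => c₂ n ^ 2 * Real.exp (2 * lam n * T)))
    (u₁ u₂ : ℝ → H)
    (hu₁ : ∀ t, u₁ t = ∑' n, (c₁ n * Real.exp (lam n * t)) • φ n)
    (hu₂ : ∀ t, u₂ t = ∑' n, (c₂ n * Real.exp (lam n * t)) • φ n)
    (hinit₁ : ‖u₁ 0 - g‖ ≤ δ) (hinit₂ : ‖u₂ 0 - g‖ ≤ δ)
    (hbound₁ : ‖u₁ T‖ ≤ M) (hbound₂ : ‖u₂ T‖ ≤ M)
    (hsecb₁ : ‖u₁ T - u₁ s‖ ≤ K * δ) (hsecb₂ : ‖u₂ T - u₂ s‖ ≤ K * δ) :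
    (∀ t ∈ Set.Icc (0 : ℝ) T, ‖u₁ t - u₂ t‖ ≤ 2 * Λ ^ (t / T) * δ) ∧ Λ < M / δ := by
  have hN : 1 < M / δ := by linarith
  have hlogN : 0 < Real.log (M / δ) := Real.log_pos hN
  have hpN : s / T < Real.log (M / δ - K) / Real.log (M / δ) := by
    rw [div_lt_iff₀ hT]
    exact hss.trans_eq (by ring)
  have hp1 : s / T < 1 := hpN.trans <| (div_lt_one hlogN).2 <|
    Real.log_lt_log (by linarith) (by linarith)
  have hsT : s < T := (div_lt_one hT).1 hp1
  have hNp : (M / δ) ^ (s / T) < M / δ - K := by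
    rw [Real.rpow_def_of_pos (by linarith), ← Real.lt_log_iff_exp_lt (by linarith), mul_comm]
    exact (lt_div_iff₀ hlogN).1 hpN
  have hΛN : Λ < M / δ := by
    refine lt_of_le_of_ne (le_of_le_add_rpow_s10 hK hp1.le (by linarith) hroot.le (by linarith)) ?_
    rintro rfl
    linarith
  refine ⟨fun t ht => ?_, hΛN⟩
  have hw : ∀ r ≤ T, HasSum (fun n => ((c₁ n - c₂ n) * Real.exp (lam n * r)) ^ 2)
      (‖u₁ r - u₂ r‖ ^ 2) := fun r hr => by
    have h₁ := (hφ.summable_smul_of_summable_sq (summable_mul_exp_of_le hpos hr hsum₁)).hasSum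
    have h₂ := (hφ.summable_smul_of_summable_sq (summable_mul_exp_of_le hpos hr hsum₂)).hasSum
    rw [← hu₁] at h₁
    rw [← hu₂] at h₂
    refine hφ.hasSum_sq_of_hasSum_smul ?_
    simpa only [sub_mul, sub_smul] using h₁.sub h₂
  have hw0 : ‖u₁ 0 - u₂ 0‖ ≤ 2 * δ := by
    have h := norm_sub_le (u₁ 0 - g) (u₂ 0 - g)
    rw [sub_sub_sub_cancel_right] at h
    linarith
  have hinterp : ∀ b, 0 < b → ‖u₁ T - u₂ T‖ ≤ 2 * δ * b → ∀ r ∈ Set.Icc (0 : ℝ) T,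
      ‖u₁ r - u₂ r‖ ≤ 2 * b ^ (r / T) * δ := fun b hb hwb r hr => by
    have h := le_rpow_mul_rpow_of_hasSum_exp hT hr (a := 2 * δ) (b := 2 * δ * b)
      (by positivity) (by positivity) (norm_nonneg _)
      (pow_le_pow_left₀ (norm_nonneg _) hw0 2) (pow_le_pow_left₀ (norm_nonneg _) hwb 2)
      (hw 0 hT.le) (hw T le_rfl) (hw r hr.2)
    rw [Real.mul_rpow (by positivity) hb.le, ← mul_assoc, ← Real.rpow_add (by positivity),
      sub_add_cancel, Real.rpow_one] at h
    linarith
  refine hinterp Λ hΛ ?_ t ht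
  rcases (norm_nonneg (u₁ T - u₂ T)).eq_or_lt with h0 | h0
  · rw [← h0]
    positivity
  have hy : ‖u₁ T - u₂ T‖ = 2 * δ * (‖u₁ T - u₂ T‖ / (2 * δ)) := by field_simp
  have hws := hinterp _ (by positivity) hy.le s ⟨hs.le, hsT.le⟩
  have htri : ‖u₁ T - u₂ T‖ ≤ K * δ + K * δ + ‖u₁ s - u₂ s‖ := by
    have h : u₁ T - u₂ T = (u₁ T - u₁ s) - (u₂ T - u₂ s) + (u₁ s - u₂ s) := by abel
    rw [h]
    refine (norm_add_le _ _).trans (add_le_add_left ((norm_sub_le _ _).trans ?_) _)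
    exact add_le_add hsecb₁ hsecb₂
  rw [hy]
  refine mul_le_mul_of_nonneg_left (le_of_le_add_rpow_s10 hK hp1.le hΛ ?_ hroot.ge) (by positivity)
  refine le_of_mul_le_mul_left ?_ (show 0 < 2 * δ by positivity)
  rw [← hy]
  linarith
end

section
/- Let H be a real Hilbert space, let φ_1, …, φ_N be an orthonormal family in H, and let λ_1 ≤ … ≤ λ_N be positive reals. Let T > 0, 0 < s < T, δ > 0, K > 0, and g ∈ H. For j = 1, 2 let u_{j0} ∈ H and define u_j(t) = ∑_{k=1}^{N} e^{λ_k t} (u_{j0}, φ_k) φ_k for t ∈ [0, T]. Assume ‖u_{j0} − g‖ ≤ δ and ‖u_j(T) − u_j(s)‖ ≤ Kδ for j = 1, 2. Then for every t ∈ [0, T], ‖u_1(t) − u_2(t)‖ ≤ 2 Λ^{t/T} δ, where Λ is the unique positive root of the equation x = K + x^{s/T}. -/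
open scoped RealInnerProductSpace

/-- The squared norm of a combination of an orthonormal family. -/
lemma Orthonormal.norm_sum_smul_sq {ι H : Type*} [Fintype ι] [NormedAddCommGroup H]
    [InnerProductSpace ℝ H] {φ : ι → H} (hφ : Orthonormal ℝ φ) (b : ι → ℝ) :
    ‖∑ k, b k • φ k‖ ^ 2 = ∑ k, b k ^ 2 := by
  rw [← real_inner_self_eq_norm_sq, hφ.inner_sum]
  simp [sq]

/-- Logarithmic convexity in time of the norm of an exponential sum over an orthonormal family. -/
lemma Orthonormal.norm_sum_exp_le {ι H : Type*} [Fintype ι] [NormedAddCommGroup H]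
    [InnerProductSpace ℝ H] {φ : ι → H} (hφ : Orthonormal ℝ φ) (lam c : ι → ℝ)
    {T t : ℝ} (ht : 0 ≤ t) (htT : t ≤ T) (hT : 0 < T) :
    ‖∑ k, (Real.exp (lam k * t) * c k) • φ k‖ ≤
      ‖∑ k, c k • φ k‖ ^ (1 - t / T) *
        ‖∑ k, (Real.exp (lam k * T) * c k) • φ k‖ ^ (t / T) := by
  rcases ht.eq_or_lt with rfl | ht
  · simp
  refine le_of_sq_le_sq ?_ (by positivity)
  have holder := Real.inner_le_weight_mul_Lp_of_nonneg Finset.univ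
    (p := T / t) ((one_le_div ht).2 htT) (fun k => c k ^ 2) (fun k => Real.exp (lam k * t) ^ 2)
    (fun k => sq_nonneg _) (fun k => sq_nonneg _)
  have hexp (k : ι) : (Real.exp (lam k * t) ^ 2) ^ (T / t) = Real.exp (lam k * T) ^ 2 := by
    rw [← Real.exp_nat_mul, ← Real.exp_nat_mul, ← Real.exp_mul]
    congr 1
    field_simp
  have hpow (a x : ℝ) (ha : 0 ≤ a) : (a ^ x) ^ 2 = (a ^ 2) ^ x := by
    rw [← Real.rpow_natCast, ← Real.rpow_natCast, ← Real.rpow_mul ha, ← Real.rpow_mul ha, mul_comm]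
  rw [mul_pow, hpow _ _ (norm_nonneg _), hpow _ _ (norm_nonneg _)]
  simp only [hφ.norm_sum_smul_sq, mul_pow]
  simpa only [hexp, inv_div, mul_comm (c _ ^ 2)] using holder

/-- A subsolution of `x = K + x ^ θ` lies below any positive root. -/
lemma le_of_le_add_rpow_s12 {K θ x y : ℝ} (hK : 0 < K) (hθ : θ ≤ 1) (hy : 0 < y)
    (hroot : y = K + y ^ θ) (hx : x ≤ K + x ^ θ) : x ≤ y := by
  by_contra! h
  have hr : 1 < x / y := (one_lt_div hy).2 h
  have hxr : x = x / y * y := by field_simp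
  have h1 : x ^ θ ≤ x / y * y ^ θ := by
    conv_lhs => rw [hxr, Real.mul_rpow (by positivity) hy.le]
    gcongr
    simpa using Real.rpow_le_rpow_of_exponent_le hr.le hθ
  have h2 : x = x / y * K + x / y * y ^ θ := by
    rw [← mul_add, ← hroot]
    exact hxr
  nlinarith

/-- Stability of the truncated-spectral (regularized) solutions: if
`uⱼ(t) = ∑_{k=1}^{N} e^{λ_k t} (u_{j0}, φ_k) φ_k` satisfy `‖u_{j0} − g‖ ≤ δ` and
the SECB constraint `‖uⱼ(T) − uⱼ(s)‖ ≤ Kδ`, then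
`‖u₁(t) − u₂(t)‖ ≤ 2 Λ^{t/T} δ` for all `t ∈ [0,T]`, where `Λ` is the unique
positive root of `x = K + x^{s/T}`. -/
theorem regularized_solution_stability
    {H : Type*} [NormedAddCommGroup H] [InnerProductSpace ℝ H] [CompleteSpace H]
    (N : ℕ) (φ : Fin N → H) (hφ : Orthonormal ℝ φ)
    (lam : Fin N → ℝ) (hmono : Monotone lam) (hpos : ∀ k, 0 < lam k)
    (T s δ K Λ : ℝ) (hT : 0 < T) (hs : 0 < s) (hsT : s < T) (hδ : 0 < δ) (hK : 0 < K)
    (hΛ : 0 < Λ) (hroot : Λ = K + Λ ^ (s / T))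
    (g u₁₀ u₂₀ : H)
    (u₁ u₂ : ℝ → H)
    (hu₁ : ∀ t, u₁ t = ∑ k, (Real.exp (lam k * t) * ⟪u₁₀, φ k⟫) • φ k)
    (hu₂ : ∀ t, u₂ t = ∑ k, (Real.exp (lam k * t) * ⟪u₂₀, φ k⟫) • φ k)
    (hinit₁ : ‖u₁₀ - g‖ ≤ δ) (hinit₂ : ‖u₂₀ - g‖ ≤ δ)
    (hsecb₁ : ‖u₁ T - u₁ s‖ ≤ K * δ) (hsecb₂ : ‖u₂ T - u₂ s‖ ≤ K * δ) :
    ∀ t ∈ Set.Icc (0 : ℝ) T, ‖u₁ t - u₂ t‖ ≤ 2 * Λ ^ (t / T) * δ := by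
  intro t ht
  set c : Fin N → ℝ := fun k => ⟪u₁₀ - u₂₀, φ k⟫ with hc
  have hw (r : ℝ) : u₁ r - u₂ r = ∑ k, (Real.exp (lam k * r) * c k) • φ k := by
    simp only [hu₁, hu₂, hc, ← Finset.sum_sub_distrib, ← sub_smul, inner_sub_left, mul_sub]
  have hconv {r : ℝ} (h0 : 0 ≤ r) (h1 : r ≤ T) := hφ.norm_sum_exp_le lam c h0 h1 hT
  simp only [← hw] at hconv
  have hbessel : ‖∑ k, c k • φ k‖ ≤ 2 * δ := by
    have h1 : ‖∑ k, c k • φ k‖ ≤ ‖u₁₀ - u₂₀‖ := by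
      refine le_of_sq_le_sq ?_ (norm_nonneg _)
      rw [hφ.norm_sum_smul_sq]
      simpa [hc, real_inner_comm] using
        hφ.sum_inner_products_le (u₁₀ - u₂₀) (s := Finset.univ)
    have h2 := norm_sub_le (u₁₀ - g) (u₂₀ - g)
    rw [sub_sub_sub_cancel_right] at h2
    linarith
  obtain ⟨x, hx⟩ : ∃ x, x = ‖u₁ T - u₂ T‖ / (2 * δ) := ⟨_, rfl⟩
  have hx0 : 0 ≤ x := by rw [hx]; positivity
  have hxT : ‖u₁ T - u₂ T‖ = 2 * δ * x := by rw [hx]; field_simp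
  have hbound {r : ℝ} (h0 : 0 ≤ r) (h1 : r ≤ T) : ‖u₁ r - u₂ r‖ ≤ 2 * δ * x ^ (r / T) := by
    have hrT : 0 ≤ 1 - r / T := sub_nonneg.2 ((div_le_one hT).2 h1)
    calc ‖u₁ r - u₂ r‖
        ≤ ‖∑ k, c k • φ k‖ ^ (1 - r / T) * ‖u₁ T - u₂ T‖ ^ (r / T) := hconv h0 h1
      _ ≤ (2 * δ) ^ (1 - r / T) * ‖u₁ T - u₂ T‖ ^ (r / T) := by gcongr
      _ = 2 * δ * x ^ (r / T) := by
        rw [hxT, Real.mul_rpow (by positivity) hx0, ← mul_assoc,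
          ← Real.rpow_add (by positivity), sub_add_cancel, Real.rpow_one]
  have hxΛ : x ≤ Λ := by
    refine le_of_le_add_rpow_s12 hK ((div_le_one hT).2 hsT.le) hΛ hroot ?_
    have h1 : ‖u₁ T - u₂ T‖ ≤ ‖u₁ T - u₁ s‖ + ‖u₂ T - u₂ s‖ + ‖u₁ s - u₂ s‖ := by
      have h2 : u₁ T - u₂ T = (u₁ T - u₁ s) - (u₂ T - u₂ s) + (u₁ s - u₂ s) := by abel
      rw [h2]
      exact (norm_add_le _ _).trans (by gcongr; exact norm_sub_le _ _)
    have h3 := hbound hs.le hsT.le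
    refine le_of_mul_le_mul_left (a := 2 * δ) ?_ (by positivity)
    linarith
  calc ‖u₁ t - u₂ t‖ ≤ 2 * δ * x ^ (t / T) := hbound ht.1 ht.2
    _ ≤ 2 * δ * Λ ^ (t / T) := by
      have := div_nonneg ht.1 hT.le
      gcongr
    _ = 2 * Λ ^ (t / T) * δ := by ring
end

section
/- Let γ ∈ ℝ, ν > 0, σ > 0, and define the contour parametrization z(y) = γ − √(ν² + y²) + iσy for y ∈ ℝ, with derivative z′(y) = −y/√(ν² + y²) + iσ. Let t > 0 and λ ∈ ℝ with λ ≠ γ − ν. Then the improper integral (1/(2πi)) ∫_{−∞}^{∞} e^{z(y)t} (z(y) − λ)^{−1} z′(y) dy converges and equals e^{λt} if λ < γ − ν, and equals 0 if λ > γ − ν. -/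
open MeasureTheory Complex

/-- The left-opening contour `y ↦ (a - √(ν² + y²)) + iσy`; its rightmost point is `a - ν` when
`0 ≤ ν`. -/
noncomputable def leftContour (a ν σ y : ℝ) : ℂ :=
  ((a - Real.sqrt (ν ^ 2 + y ^ 2) : ℝ) : ℂ) + I * σ * y

/-- The derivative of `leftContour a ν σ`. -/
noncomputable def leftContourDeriv (ν σ y : ℝ) : ℂ :=
  ((-(y / Real.sqrt (ν ^ 2 + y ^ 2)) : ℝ) : ℂ) + I * σ

section

open Filter Topology Asymptotics

lemma leftContour_re (a ν σ y : ℝ) :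
    (leftContour a ν σ y).re = a - Real.sqrt (ν ^ 2 + y ^ 2) := by
  simp [leftContour]

lemma leftContour_im (a ν σ y : ℝ) : (leftContour a ν σ y).im = σ * y := by
  simp [leftContour]

lemma leftContour_re_le (a ν σ y : ℝ) : (leftContour a ν σ y).re ≤ a - |y| := by
  rw [leftContour_re]
  have := Real.abs_le_sqrt (show y ^ 2 ≤ ν ^ 2 + y ^ 2 by nlinarith [sq_nonneg ν])
  linarith

lemma leftContour_ne_zero {a ν σ : ℝ} (hν : 0 < ν) (hσ : 0 < σ) (ha : a ≠ ν) (y : ℝ) :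
    leftContour a ν σ y ≠ 0 := by
  intro h
  have him := leftContour_im a ν σ y
  have hre := leftContour_re a ν σ y
  rw [h, zero_im] at him
  obtain rfl : y = 0 := by simpa [hσ.ne'] using him.symm
  apply ha
  simp [h, Real.sqrt_sq hν.le] at hre
  linarith

lemma leftContour_mem_slitPlane {a ν σ : ℝ} (hν : 0 < ν) (hσ : 0 < σ) (ha : ν < a) (y : ℝ) :
    leftContour a ν σ y ∈ slitPlane := by
  rw [mem_slitPlane_iff, leftContour_im, leftContour_re]
  rcases eq_or_ne y 0 with rfl | hy
  · left
    simpa [Real.sqrt_sq hν.le] using ha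
  · exact Or.inr (mul_ne_zero hσ.ne' hy)

lemma neg_leftContour_mem_slitPlane {a ν σ : ℝ} (hν : 0 < ν) (hσ : 0 < σ) (ha : a < ν) (y : ℝ) :
    -leftContour a ν σ y ∈ slitPlane := by
  rw [mem_slitPlane_iff, neg_im, neg_re, leftContour_im, leftContour_re]
  rcases eq_or_ne y 0 with rfl | hy
  · left
    simpa [Real.sqrt_sq hν.le] using ha
  · exact Or.inr (neg_ne_zero.2 (mul_ne_zero hσ.ne' hy))

lemma hasDerivAt_leftContour {ν : ℝ} (hν : 0 < ν) (a σ y : ℝ) :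
    HasDerivAt (leftContour a ν σ) (leftContourDeriv ν σ y) y := by
  have hpos : 0 < ν ^ 2 + y ^ 2 := by positivity
  have h1 : HasDerivAt (fun y : ℝ => a - Real.sqrt (ν ^ 2 + y ^ 2))
      (-(y / Real.sqrt (ν ^ 2 + y ^ 2))) y := by
    have h2 : HasDerivAt (fun y : ℝ => ν ^ 2 + y ^ 2) (2 * y) y := by
      simpa using (hasDerivAt_pow 2 y).const_add (ν ^ 2)
    refine ((h2.sqrt hpos.ne').const_sub a).congr_deriv ?_
    rw [mul_div_mul_left _ _ two_ne_zero]
  have h3 : HasDerivAt (fun y : ℝ => I * σ * (y : ℂ)) (I * σ) y := by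
    simpa using (hasDerivAt_id y).ofReal_comp.const_mul (I * σ)
  exact h1.ofReal_comp.add h3

lemma continuous_leftContourDeriv {ν : ℝ} (hν : 0 < ν) (σ : ℝ) :
    Continuous (leftContourDeriv ν σ) := by
  unfold leftContourDeriv
  have h : ∀ y : ℝ, Real.sqrt (ν ^ 2 + y ^ 2) ≠ 0 := fun y =>
    (Real.sqrt_pos.2 (by positivity)).ne'
  fun_prop (disch := exact h _)

lemma continuous_leftContour {ν : ℝ} (hν : 0 < ν) (a σ : ℝ) : Continuous (leftContour a ν σ) :=
  continuous_iff_continuousAt.2 fun y => (hasDerivAt_leftContour hν a σ y).continuousAt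

lemma norm_leftContourDeriv_le (ν : ℝ) {σ : ℝ} (hσ : 0 < σ) (y : ℝ) :
    ‖leftContourDeriv ν σ y‖ ≤ 1 + σ := by
  refine (norm_add_le _ _).trans (add_le_add ?_ (by simp [abs_of_pos hσ]))
  rw [norm_real, norm_neg, norm_div, Real.norm_eq_abs, Real.norm_eq_abs,
    abs_of_nonneg (Real.sqrt_nonneg _)]
  exact div_le_one_of_le₀ (Real.abs_le_sqrt (by nlinarith [sq_nonneg ν])) (Real.sqrt_nonneg _)

lemma continuous_exp_div_leftContour {a ν σ : ℝ} (t : ℝ) (hν : 0 < ν) (hσ : 0 < σ) (ha : a ≠ ν) :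
    Continuous fun y : ℝ => exp (leftContour a ν σ y * t) * (leftContour a ν σ y)⁻¹ *
      leftContourDeriv ν σ y := by
  have h1 := continuous_leftContour hν a σ
  have h2 := continuous_leftContourDeriv hν σ
  have h3 := leftContour_ne_zero hν hσ ha
  fun_prop (disch := exact h3)

lemma norm_exp_div_leftContour_le {a ν σ t y : ℝ} (hσ : 0 < σ) (ht : 0 < t) (hy : 1 ≤ |y|) :
    ‖exp (leftContour a ν σ y * t) * (leftContour a ν σ y)⁻¹ * leftContourDeriv ν σ y‖ ≤
      Real.exp (a * t) * σ⁻¹ * (1 + σ) * Real.exp (-t * |y|) := by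
  have h1 : ‖exp (leftContour a ν σ y * t)‖ ≤ Real.exp (a * t) * Real.exp (-t * |y|) := by
    rw [norm_exp, ← Real.exp_add, re_mul_ofReal]
    apply Real.exp_le_exp.2
    nlinarith [leftContour_re_le a ν σ y]
  have h2 : ‖(leftContour a ν σ y)⁻¹‖ ≤ σ⁻¹ := by
    rw [norm_inv]
    apply inv_anti₀ hσ
    have := abs_im_le_norm (leftContour a ν σ y)
    rw [leftContour_im, abs_mul, abs_of_pos hσ] at this
    nlinarith
  calc _ ≤ Real.exp (a * t) * Real.exp (-t * |y|) * σ⁻¹ * (1 + σ) := by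
        rw [norm_mul, norm_mul]
        gcongr
        exact norm_leftContourDeriv_le ν hσ y
    _ = _ := by ring

lemma integrable_exp_div_leftContour {a ν σ t : ℝ} (hν : 0 < ν) (hσ : 0 < σ) (ht : 0 < t)
    (ha : a ≠ ν) :
    Integrable fun y : ℝ => exp (leftContour a ν σ y * t) * (leftContour a ν σ y)⁻¹ *
      leftContourDeriv ν σ y := by
  refine (continuous_exp_div_leftContour t hν hσ ha).locallyIntegrable
    |>.integrable_of_isBigO_atBot_atTop (g := fun y => Real.exp (t * y))
      (g' := fun y => Real.exp (-t * y)) ?_ ⟨Set.Iic 0, Iic_mem_atBot 0, ?_⟩ ?_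
      ⟨Set.Ioi 0, Ioi_mem_atTop 0, integrableOn_exp_mul_Ioi (neg_lt_zero.2 ht) 0⟩
  · refine IsBigO.of_bound (Real.exp (a * t) * σ⁻¹ * (1 + σ)) ?_
    filter_upwards [eventually_le_atBot (-1)] with y hy
    have hy' : |y| = -y := abs_of_neg (by linarith)
    have := norm_exp_div_leftContour_le (a := a) (ν := ν) hσ ht
      (show 1 ≤ |y| by rw [hy']; linarith)
    rw [hy', neg_mul_neg] at this
    simpa [Real.abs_exp] using this
  · exact integrableOn_exp_mul_Iic ht 0
  · refine IsBigO.of_bound (Real.exp (a * t) * σ⁻¹ * (1 + σ)) ?_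
    filter_upwards [eventually_ge_atTop 1] with y hy
    have hy' : |y| = y := abs_of_pos (by linarith)
    have := norm_exp_div_leftContour_le (a := a) (ν := ν) hσ ht (show 1 ≤ |y| by rwa [hy'])
    rw [hy'] at this
    simpa [Real.abs_exp] using this

lemma exists_hasDerivAt_exp_sub_one_div (t : ℂ) :
    ∃ F : ℂ → ℂ, ∀ w ≠ 0, HasDerivAt F ((exp (w * t) - 1) * w⁻¹) w := by
  have hd : Differentiable ℂ (dslope (fun w : ℂ => exp (w * t)) 0) := by
    rw [← differentiableOn_univ, differentiableOn_dslope univ_mem]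
    fun_prop
  obtain ⟨F, hF⟩ := hd.isExactOn_univ
  refine ⟨F, fun w hw => (hF w (Set.mem_univ w)).congr_deriv ?_⟩
  simp [dslope_of_ne _ hw, slope, mul_comm]

lemma hasDerivAt_add_log {F : ℂ → ℂ} {t : ℂ} {w : ℂ}
    (hF : ∀ w ≠ 0, HasDerivAt F ((exp (w * t) - 1) * w⁻¹) w) (hw : w ∈ slitPlane) :
    HasDerivAt (fun w => F w + log w) (exp (w * t) * w⁻¹) w :=
  ((hF w (slitPlane_ne_zero hw)).add (hasDerivAt_log hw)).congr_deriv (by ring)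

lemma hasDerivAt_add_log_neg {F : ℂ → ℂ} {t : ℂ} {w : ℂ}
    (hF : ∀ w ≠ 0, HasDerivAt F ((exp (w * t) - 1) * w⁻¹) w) (hw : -w ∈ slitPlane) :
    HasDerivAt (fun w => F w + log (-w)) (exp (w * t) * w⁻¹) w := by
  refine ((hF w (neg_ne_zero.1 (slitPlane_ne_zero hw))).add
    ((hasDerivAt_neg w).clog hw)).congr_deriv ?_
  rw [div_neg, neg_div, neg_neg, one_div]
  ring

/-- A primitive of `exp (w * t) / w` on the left half-plane takes asymptotically equal values at
the two ends of the contour. -/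
lemma tendsto_sub_leftContour_neg {G : ℂ → ℂ} {ν σ t : ℝ} (a : ℝ) (hσ : 0 < σ) (ht : 0 < t)
    (hG : ∀ w : ℂ, -w ∈ slitPlane → HasDerivAt G (exp (w * t) * w⁻¹) w) :
    Tendsto (fun R => G (leftContour a ν σ R) - G (leftContour a ν σ (-R))) atTop (𝓝 0) := by
  have hlim : Tendsto (fun R : ℝ => Real.exp (a * t) * (2 * σ) * (R ^ (1 : ℝ) * Real.exp (-t * R)))
      atTop (𝓝 0) := by
    simpa using (tendsto_rpow_mul_exp_neg_mul_atTop_nhds_zero 1 t ht).const_mul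
      (Real.exp (a * t) * (2 * σ))
  refine squeeze_zero_norm' ?_ hlim
  filter_upwards [eventually_ge_atTop (a + 1), eventually_ge_atTop 0] with R hR hR0
  have hconv : Convex ℝ {w : ℂ | w.re ≤ a - R} := convex_halfSpace_re_le _
  have hmem : ∀ y : ℝ, |y| = R → leftContour a ν σ y ∈ {w : ℂ | w.re ≤ a - R} := fun y hy => by
    simpa [hy] using leftContour_re_le a ν σ y
  have hbound : ∀ w ∈ {w : ℂ | w.re ≤ a - R},
      ‖exp (w * t) * w⁻¹‖ ≤ Real.exp (a * t) * Real.exp (-t * R) := fun w hw => by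
    rw [Set.mem_ofPred_eq] at hw
    have h1 : 1 ≤ ‖w‖ := by
      have := (neg_le_abs w.re).trans (abs_re_le_norm w)
      linarith
    rw [norm_mul, norm_exp, norm_inv, ← Real.exp_add, re_mul_ofReal]
    refine (mul_le_of_le_one_right (Real.exp_pos _).le (inv_le_one_of_one_le₀ h1)).trans ?_
    apply Real.exp_le_exp.2
    nlinarith
  have hderiv : ∀ w ∈ {w : ℂ | w.re ≤ a - R},
      HasDerivWithinAt G (exp (w * t) * w⁻¹) {w : ℂ | w.re ≤ a - R} w := fun w hw => by
    rw [Set.mem_ofPred_eq] at hw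
    refine (hG w (Or.inl ?_)).hasDerivWithinAt
    rw [neg_re]
    linarith
  refine (hconv.norm_image_sub_le_of_norm_hasDerivWithin_le hderiv hbound
    (hmem (-R) (by rw [abs_neg, abs_of_nonneg hR0])) (hmem R (abs_of_nonneg hR0))).trans_eq ?_
  have hdist : leftContour a ν σ R - leftContour a ν σ (-R) = ((2 * σ * R : ℝ) : ℂ) * I := by
    simp only [leftContour, neg_sq]
    push_cast
    ring
  rw [hdist, norm_mul, norm_I, norm_real, Real.norm_of_nonneg (by positivity), Real.rpow_one]
  ring

lemma log_eq_log_neg_add_pi_mul_I {w : ℂ} (hw : 0 < w.im) : log w = log (-w) + Real.pi * I := by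
  simp only [log, norm_neg, arg_neg_eq_arg_sub_pi_of_im_pos hw]
  push_cast
  ring

lemma log_eq_log_neg_sub_pi_mul_I {w : ℂ} (hw : w.im < 0) : log w = log (-w) - Real.pi * I := by
  simp only [log, norm_neg, arg_neg_eq_arg_add_pi_of_im_neg hw]
  push_cast
  ring

lemma integral_exp_div_leftContour_eq_of_tendsto {G : ℂ → ℂ} {a ν σ t : ℝ} {L : ℂ} (hν : 0 < ν)
    (hσ : 0 < σ) (ht : 0 < t) (ha : a ≠ ν)
    (hG : ∀ y, HasDerivAt G (exp (leftContour a ν σ y * t) * (leftContour a ν σ y)⁻¹)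
      (leftContour a ν σ y))
    (hL : Tendsto (fun R => G (leftContour a ν σ R) - G (leftContour a ν σ (-R))) atTop (𝓝 L)) :
    ∫ y : ℝ, exp (leftContour a ν σ y * t) * (leftContour a ν σ y)⁻¹ * leftContourDeriv ν σ y =
      L := by
  refine tendsto_nhds_unique (intervalIntegral_tendsto_integral
    (integrable_exp_div_leftContour hν hσ ht ha) tendsto_neg_atTop_atBot tendsto_id) ?_
  refine hL.congr fun R => ?_
  exact (intervalIntegral.integral_eq_sub_of_hasDerivAt
    (fun y _ => (hG y).comp_of_eq y (hasDerivAt_leftContour hν a σ y) rfl)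
    ((continuous_exp_div_leftContour t hν hσ ha).intervalIntegrable _ _)).symm

lemma integral_exp_div_leftContour {a ν σ t : ℝ} (hν : 0 < ν) (hσ : 0 < σ) (ht : 0 < t)
    (ha : a ≠ ν) :
    ∫ y : ℝ, exp (leftContour a ν σ y * t) * (leftContour a ν σ y)⁻¹ * leftContourDeriv ν σ y =
      if ν < a then 2 * Real.pi * I else 0 := by
  obtain ⟨F, hF⟩ := exists_hasDerivAt_exp_sub_one_div (t : ℂ)
  have hlim := tendsto_sub_leftContour_neg (ν := ν) a hσ ht
    fun w hw => hasDerivAt_add_log_neg hF hw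
  split_ifs with h
  · refine integral_exp_div_leftContour_eq_of_tendsto hν hσ ht ha
      (fun y => hasDerivAt_add_log hF (leftContour_mem_slitPlane hν hσ h y)) ?_
    rw [← zero_add (2 * Real.pi * I)]
    refine (hlim.add_const (2 * Real.pi * I)).congr' ?_
    filter_upwards [eventually_gt_atTop 0] with R hR
    rw [log_eq_log_neg_add_pi_mul_I (w := leftContour a ν σ R)
        (by rw [leftContour_im]; positivity),
      log_eq_log_neg_sub_pi_mul_I (w := leftContour a ν σ (-R))
        (by rw [leftContour_im]; nlinarith [mul_pos hσ hR])]
    ring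
  · exact integral_exp_div_leftContour_eq_of_tendsto hν hσ ht ha
      (fun y => hasDerivAt_add_log_neg hF (neg_leftContour_mem_slitPlane hν hσ
        (lt_of_le_of_ne (not_lt.1 h) ha) y)) hlim

end

/-- Residue computation on the left-opening contour `z(y) = γ − √(ν² + y²) + iσy`:
for `t > 0` and real `λ ≠ γ − ν`, the integral
`(1/(2πi)) ∫ e^{z(y)t} (z(y) − λ)⁻¹ z′(y) dy` converges; it equals `e^{λt}`
if `λ` lies to the left of the contour (`λ < γ − ν`) and `0` if it lies to the
right (`λ > γ − ν`). -/
theorem contour_residue_computation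
    (γ ν σ t lam : ℝ) (hν : 0 < ν) (hσ : 0 < σ) (ht : 0 < t) (hlam : lam ≠ γ - ν) :
    Integrable (fun y : ℝ =>
      Complex.exp ((((γ - Real.sqrt (ν ^ 2 + y ^ 2) : ℝ) : ℂ) + Complex.I * σ * y) * t) *
        ((((γ - Real.sqrt (ν ^ 2 + y ^ 2) : ℝ) : ℂ) + Complex.I * σ * y) - lam)⁻¹ *
        (((-(y / Real.sqrt (ν ^ 2 + y ^ 2)) : ℝ) : ℂ) + Complex.I * σ)) ∧
    (1 / (2 * Real.pi * Complex.I)) *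
        ∫ y : ℝ,
          Complex.exp ((((γ - Real.sqrt (ν ^ 2 + y ^ 2) : ℝ) : ℂ) + Complex.I * σ * y) * t) *
            ((((γ - Real.sqrt (ν ^ 2 + y ^ 2) : ℝ) : ℂ) + Complex.I * σ * y) - lam)⁻¹ *
            (((-(y / Real.sqrt (ν ^ 2 + y ^ 2)) : ℝ) : ℂ) + Complex.I * σ) =
      if lam < γ - ν then Complex.exp (lam * t) else 0 := by
  have ha : γ - lam ≠ ν := fun h => hlam (by linarith)
  have hfun : (fun y : ℝ =>
      Complex.exp ((((γ - Real.sqrt (ν ^ 2 + y ^ 2) : ℝ) : ℂ) + Complex.I * σ * y) * t) *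
        ((((γ - Real.sqrt (ν ^ 2 + y ^ 2) : ℝ) : ℂ) + Complex.I * σ * y) - lam)⁻¹ *
        (((-(y / Real.sqrt (ν ^ 2 + y ^ 2)) : ℝ) : ℂ) + Complex.I * σ)) =
      fun y : ℝ => exp (lam * t) * (exp (leftContour (γ - lam) ν σ y * t) *
        (leftContour (γ - lam) ν σ y)⁻¹ * leftContourDeriv ν σ y) := by
    funext y
    have hz : ((γ - Real.sqrt (ν ^ 2 + y ^ 2) : ℝ) : ℂ) + I * σ * y =
        leftContour (γ - lam) ν σ y + lam := by
      simp only [leftContour]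
      push_cast
      ring
    rw [hz, add_sub_cancel_right, add_mul, exp_add, leftContourDeriv]
    ring
  rw [hfun]
  refine ⟨(integrable_exp_div_leftContour hν hσ ht ha).const_mul _, ?_⟩
  rw [integral_const_mul, integral_exp_div_leftContour hν hσ ht ha]
  have hiff : ν < γ - lam ↔ lam < γ - ν := by constructor <;> intro h <;> linarith
  simp only [hiff]
  split_ifs
  · have hpi : (2 * Real.pi * I : ℂ) ≠ 0 := two_pi_I_ne_zero
    rw [mul_left_comm, one_div_mul_cancel hpi, mul_one]
  · simp
end

section
/- Let H be a complex Hilbert space, (φ_k)_{k∈ℕ} an orthonormal family in H, and λ : ℕ → ℝ a nondecreasing sequence with λ_k > 0 for all k and λ_k → ∞. Let c : ℕ → ℂ with ∑_k |c_k|² < ∞. Let γ ∈ ℝ, ν > 0, σ > 0, and define the contour parametrization z(y) = γ − √(ν² + y²) + iσy for y ∈ ℝ, with derivative z′(y) = −y/√(ν² + y²) + iσ. Suppose N ∈ ℕ is such that λ_k < γ − ν for all k ≤ N and λ_k > γ − ν for all k > N. For z ∈ ℂ with z ≠ λ_k for all k, define v(z) = ∑_k c_k (z − λ_k)^{−1}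 φ_k. Then for every t > 0, the Bochner integral (1/(2πi)) ∫_{−∞}^{∞} e^{z(y)t} v(z(y)) z′(y) dy converges and equals ∑_{k=1}^{N} c_k e^{λ_k t} φ_k. -/
open MeasureTheory Complex
open Filter Topology

/-- The left-opening hyperbola branch `y ↦ γ − √(ν² + y²) + iσy`. -/
noncomputable def hyperbola (γ ν σ y : ℝ) : ℂ :=
  ((γ - Real.sqrt (ν ^ 2 + y ^ 2) : ℝ) : ℂ) + Complex.I * σ * y

/-- The velocity `−y/√(ν² + y²) + iσ` of the parametrization `hyperbola`. -/
noncomputable def hyperbolaVelocity (ν σ y : ℝ) : ℂ :=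
  ((-(y / Real.sqrt (ν ^ 2 + y ^ 2)) : ℝ) : ℂ) + Complex.I * σ

section Hyperbola

variable {γ ν σ : ℝ}

@[simp] lemma hyperbola_re (y : ℝ) :
    (hyperbola γ ν σ y).re = γ - Real.sqrt (ν ^ 2 + y ^ 2) := by
  simp [hyperbola]

@[simp] lemma hyperbola_im (y : ℝ) : (hyperbola γ ν σ y).im = σ * y := by
  simp [hyperbola]

lemma hasDerivAt_hyperbola (hν : 0 < ν) (y : ℝ) :
    HasDerivAt (hyperbola γ ν σ) (hyperbolaVelocity ν σ y) y := by
  have h1 : HasDerivAt (fun y : ℝ => γ - Real.sqrt (ν ^ 2 + y ^ 2))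
      (-(y / Real.sqrt (ν ^ 2 + y ^ 2))) y := by
    refine ((((hasDerivAt_pow 2 y).const_add (ν ^ 2)).sqrt (by positivity)).const_sub
      γ).congr_deriv ?_
    have : 0 < Real.sqrt (ν ^ 2 + y ^ 2) := by positivity
    push_cast
    field_simp
  have h2 : HasDerivAt (fun y : ℝ => Complex.I * σ * (y : ℂ)) (Complex.I * σ) y := by
    simpa using ((hasDerivAt_id y).ofReal_comp).const_mul (Complex.I * σ)
  exact h1.ofReal_comp.add h2

lemma continuous_hyperbola (hν : 0 < ν) : Continuous (hyperbola γ ν σ) :=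
  continuous_iff_continuousAt.2 fun y => (hasDerivAt_hyperbola hν y).continuousAt

lemma continuous_hyperbolaVelocity (hν : 0 < ν) : Continuous (hyperbolaVelocity ν σ) := by
  have h : ∀ y : ℝ, Real.sqrt (ν ^ 2 + y ^ 2) ≠ 0 := fun y => by positivity
  unfold hyperbolaVelocity
  fun_prop (disch := exact h _)

lemma abs_le_sqrt_add_sq (ν y : ℝ) : |y| ≤ Real.sqrt (ν ^ 2 + y ^ 2) :=
  Real.abs_le_sqrt (by nlinarith [sq_nonneg ν])

lemma le_sqrt_add_sq (ν y : ℝ) : ν ≤ Real.sqrt (ν ^ 2 + y ^ 2) :=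
  Real.le_sqrt_of_sq_le (by nlinarith [sq_nonneg y])

lemma sqrt_add_sq_le (hν : 0 < ν) (y : ℝ) : Real.sqrt (ν ^ 2 + y ^ 2) ≤ ν + |y| := by
  refine Real.sqrt_le_iff.2 ⟨by positivity, ?_⟩
  nlinarith [sq_abs y, abs_nonneg y]

lemma norm_hyperbolaVelocity_le (hν : 0 < ν) (hσ : 0 < σ) (y : ℝ) :
    ‖hyperbolaVelocity ν σ y‖ ≤ 1 + σ := by
  refine (norm_add_le _ _).trans (add_le_add ?_ ?_)
  · have : 0 < Real.sqrt (ν ^ 2 + y ^ 2) := by positivity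
    rw [Complex.norm_real, norm_neg, norm_div, Real.norm_eq_abs, Real.norm_eq_abs,
      abs_of_pos this, div_le_one this]
    exact abs_le_sqrt_add_sq ν y
  · simp [abs_of_pos hσ]

lemma le_norm_hyperbola_sub (hν : 0 < ν) (hσ : 0 < σ) {d a : ℝ} (ha : d ≤ |γ - ν - a|) (y : ℝ) :
    σ * d / (1 + σ) ≤ ‖hyperbola γ ν σ y - a‖ := by
  have him : σ * |y| ≤ ‖hyperbola γ ν σ y - a‖ := by
    have := Complex.abs_im_le_norm (hyperbola γ ν σ y - a)
    simpa [abs_mul, abs_of_pos hσ] using this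
  have hre : d - |y| ≤ ‖hyperbola γ ν σ y - a‖ := by
    refine le_trans ?_ (Complex.abs_re_le_norm _)
    have h1 := sqrt_add_sq_le hν y
    have h2 := le_sqrt_add_sq ν y
    simp only [Complex.sub_re, hyperbola_re, Complex.ofReal_re]
    have h3 := abs_sub_abs_le_abs_sub (γ - ν - a) (Real.sqrt (ν ^ 2 + y ^ 2) - ν)
    rw [abs_of_nonneg (sub_nonneg.2 h2)] at h3
    rw [show γ - Real.sqrt (ν ^ 2 + y ^ 2) - a
      = γ - ν - a - (Real.sqrt (ν ^ 2 + y ^ 2) - ν) by ring]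
    linarith
  rw [div_le_iff₀ (by positivity)]
  nlinarith

lemma exists_norm_hyperbola_sub_sq_ge (hν : 0 < ν) (hσ : 0 < σ) {a : ℝ} (ha : γ - ν ≠ a) :
    ∃ m > 0, ∀ y, m * (1 + y ^ 2) ≤ ‖hyperbola γ ν σ y - a‖ ^ 2 := by
  have hd : 0 < |γ - ν - a| := abs_pos.2 (sub_ne_zero.2 ha)
  set δ := σ * |γ - ν - a| / (1 + σ) with hδ
  have hδ0 : 0 < δ := by positivity
  refine ⟨min (δ ^ 2) (σ ^ 2) / 2, by positivity, fun y => ?_⟩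
  have h1 := pow_le_pow_left₀ hδ0.le (le_norm_hyperbola_sub hν hσ (le_refl |γ - ν - a|) y) 2
  have h2 : σ ^ 2 * y ^ 2 ≤ ‖hyperbola γ ν σ y - a‖ ^ 2 := by
    have := pow_le_pow_left₀ (abs_nonneg _)
      (Complex.abs_im_le_norm (hyperbola γ ν σ y - a)) 2
    simpa [mul_pow] using this
  have h3 := min_le_left (δ ^ 2) (σ ^ 2)
  have h4 := mul_le_mul_of_nonneg_right (min_le_right (δ ^ 2) (σ ^ 2)) (sq_nonneg y)
  linarith

lemma hyperbola_sub_ne_zero (hν : 0 < ν) (hσ : 0 < σ) {a : ℝ} (ha : γ - ν ≠ a) (y : ℝ) :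
    hyperbola γ ν σ y - a ≠ 0 := by
  obtain ⟨m, hm, h⟩ := exists_norm_hyperbola_sub_sq_ge hν hσ ha
  intro h0
  have h1 := h y
  have h2 : 0 < m * (1 + y ^ 2) := by positivity
  rw [h0, norm_zero] at h1
  linarith

lemma continuous_inv_hyperbola_sub (hν : 0 < ν) (hσ : 0 < σ) {a : ℝ} (ha : γ - ν ≠ a) :
    Continuous fun y => (hyperbola γ ν σ y - a)⁻¹ :=
  ((continuous_hyperbola hν).sub continuous_const).inv₀ (hyperbola_sub_ne_zero hν hσ ha)

lemma norm_exp_hyperbola_mul (t y : ℝ) :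
    ‖Complex.exp (hyperbola γ ν σ y * t)‖ = Real.exp ((γ - Real.sqrt (ν ^ 2 + y ^ 2)) * t) := by
  simp [Complex.norm_exp]

lemma tendsto_exp_hyperbola_mul {t : ℝ} (ht : 0 < t) :
    Tendsto (fun y => Complex.exp (hyperbola γ ν σ y * t)) (cocompact ℝ) (𝓝 0) := by
  rw [tendsto_zero_iff_norm_tendsto_zero]
  simp only [norm_exp_hyperbola_mul]
  refine Real.tendsto_exp_atBot.comp (Tendsto.atBot_mul_const ht ?_)
  refine tendsto_atBot_mono (fun y => sub_le_sub_left (abs_le_sqrt_add_sq ν y) γ) ?_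
  exact tendsto_const_nhds.add_atBot (tendsto_neg_atTop_atBot.comp tendsto_norm_cocompact_atTop)

lemma integrable_exp_mul_hyperbolaVelocity (hν : 0 < ν) (hσ : 0 < σ) {t : ℝ} (ht : 0 < t) :
    Integrable fun y => Complex.exp (hyperbola γ ν σ y * t) * hyperbolaVelocity ν σ y := by
  set m := min 1 (t ^ 2 / 2) with hm
  have hm0 : 0 < m := by positivity
  refine (integrable_inv_one_add_sq.const_mul (Real.exp (γ * t) * m⁻¹ * (1 + σ))).mono'
    (Continuous.aestronglyMeasurable ?_) (ae_of_all _ fun y => ?_)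
  · have := continuous_hyperbola (γ := γ) (σ := σ) hν
    have := continuous_hyperbolaVelocity (σ := σ) hν
    fun_prop
  · rw [norm_mul, norm_exp_hyperbola_mul]
    have h0 : Real.exp ((γ - Real.sqrt (ν ^ 2 + y ^ 2)) * t)
        ≤ Real.exp (γ * t) * (Real.exp (t * |y|))⁻¹ := by
      rw [← Real.exp_neg, ← Real.exp_add]
      refine Real.exp_le_exp.2 ?_
      nlinarith [abs_le_sqrt_add_sq ν y]
    have h1 : m * (1 + y ^ 2) ≤ Real.exp (t * |y|) := by
      have h2 := Real.quadratic_le_exp_of_nonneg (x := t * |y|) (by positivity)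
      have h3 : 0 ≤ t * |y| := by positivity
      have h4 := mul_le_mul_of_nonneg_right (min_le_right 1 (t ^ 2 / 2)) (sq_nonneg y)
      have h5 := min_le_left 1 (t ^ 2 / 2)
      rw [mul_pow, sq_abs] at h2
      linarith
    have h2 : (Real.exp (t * |y|))⁻¹ ≤ (m * (1 + y ^ 2))⁻¹ := inv_anti₀ (by positivity) h1
    calc _ ≤ (Real.exp (γ * t) * (m * (1 + y ^ 2))⁻¹) * (1 + σ) := by
          refine mul_le_mul (h0.trans ?_) (norm_hyperbolaVelocity_le hν hσ y)
            (norm_nonneg _) (by positivity)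
          gcongr
      _ = _ := by rw [mul_inv]; ring

lemma integrable_exp_mul_hyperbolaVelocity_smul {E : Type*} [NormedAddCommGroup E]
    [NormedSpace ℂ E] (hν : 0 < ν) (hσ : 0 < σ) {t : ℝ} (ht : 0 < t) {g : ℝ → E} {C : ℝ}
    (hg : AEStronglyMeasurable g) (hC : ∀ y, ‖g y‖ ≤ C) :
    Integrable fun y =>
      (Complex.exp (hyperbola γ ν σ y * t) * hyperbolaVelocity ν σ y) • g y :=
  (integrable_exp_mul_hyperbolaVelocity hν hσ ht).smul_bdd C hg (ae_of_all _ hC)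

lemma norm_inv_hyperbola_sub_le (hν : 0 < ν) (hσ : 0 < σ) {d a : ℝ} (hd : 0 < d)
    (ha : d ≤ |γ - ν - a|) (y : ℝ) :
    ‖(hyperbola γ ν σ y - a)⁻¹‖ ≤ (σ * d / (1 + σ))⁻¹ := by
  rw [norm_inv]
  exact inv_anti₀ (by positivity) (le_norm_hyperbola_sub hν hσ ha y)

lemma integrable_exp_mul_inv_hyperbola_sub (hν : 0 < ν) (hσ : 0 < σ) {t : ℝ} (ht : 0 < t)
    {a : ℝ} (ha : γ - ν ≠ a) :
    Integrable fun y => Complex.exp (hyperbola γ ν σ y * t) * hyperbolaVelocity ν σ y *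
      (hyperbola γ ν σ y - a)⁻¹ :=
  integrable_exp_mul_hyperbolaVelocity_smul hν hσ ht
    (continuous_inv_hyperbola_sub hν hσ ha).aestronglyMeasurable
    (norm_inv_hyperbola_sub_le hν hσ (abs_pos.2 (sub_ne_zero.2 ha)) le_rfl)

lemma integral_exp_mul_hyperbolaVelocity (hν : 0 < ν) (hσ : 0 < σ) {t : ℝ} (ht : 0 < t) :
    ∫ y, Complex.exp (hyperbola γ ν σ y * t) * hyperbolaVelocity ν σ y = 0 := by
  have htc : (t : ℂ) ≠ 0 := by exact_mod_cast ht.ne'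
  have hlim : Tendsto (fun y => Complex.exp (hyperbola γ ν σ y * t) / t) (cocompact ℝ) (𝓝 0) := by
    simpa using (tendsto_exp_hyperbola_mul (γ := γ) (ν := ν) (σ := σ) ht).div_const (t : ℂ)
  have h := integral_of_hasDerivAt_of_tendsto
    (f := fun y => Complex.exp (hyperbola γ ν σ y * t) / t) (fun y => ?_)
    (integrable_exp_mul_hyperbolaVelocity (γ := γ) hν hσ ht)
    (hlim.mono_left atBot_le_cocompact) (hlim.mono_left atTop_le_cocompact)
  · simpa using h
  · refine (((hasDerivAt_hyperbola (γ := γ) (σ := σ) hν y).mul_const (t : ℂ)).cexp.div_const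
      (t : ℂ)).congr_deriv ?_
    field_simp

lemma norm_exp_hyperbola_sub_mul (a t y : ℝ) :
    ‖Complex.exp ((hyperbola γ ν σ y - a) * t)‖
      = Real.exp ((γ - Real.sqrt (ν ^ 2 + y ^ 2) - a) * t) := by
  simp [Complex.norm_exp]

lemma integrable_exp_sub_mul_inv_hyperbola_sub (hν : 0 < ν) (hσ : 0 < σ) {t : ℝ} (ht : 0 < t)
    {a : ℝ} (ha : γ - ν ≠ a) :
    Integrable fun y => Complex.exp ((hyperbola γ ν σ y - a) * t) * hyperbolaVelocity ν σ y *
      (hyperbola γ ν σ y - a)⁻¹ := by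
  convert (integrable_exp_mul_inv_hyperbola_sub hν hσ ht ha).const_mul (Complex.exp (-a * t))
    using 2 with y
  rw [sub_mul, sub_eq_neg_add, Complex.exp_add, neg_mul]
  ring

lemma hasDerivAt_integral_exp_sub_mul (hν : 0 < ν) (hσ : 0 < σ) {t : ℝ} (ht : 0 < t)
    {a : ℝ} (ha : γ - ν ≠ a) :
    HasDerivAt (fun s : ℝ => ∫ y, Complex.exp ((hyperbola γ ν σ y - a) * s) *
      hyperbolaVelocity ν σ y * (hyperbola γ ν σ y - a)⁻¹) 0 t := by
  have hz := continuous_hyperbola (γ := γ) (σ := σ) hν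
  have hv := continuous_hyperbolaVelocity (σ := σ) hν
  have hi := continuous_inv_hyperbola_sub hν hσ ha
  set K := Real.exp (|γ - a| * (2 * t) + |γ| * (t / 2)) with hK
  have h := (hasDerivAt_integral_of_dominated_loc_of_deriv_le (μ := volume) (x₀ := t)
    (s := Set.Ioo (t / 2) (2 * t))
    (F := fun (s : ℝ) y => Complex.exp ((hyperbola γ ν σ y - a) * s) *
      hyperbolaVelocity ν σ y * (hyperbola γ ν σ y - a)⁻¹)
    (F' := fun (s : ℝ) y => Complex.exp ((hyperbola γ ν σ y - a) * s) * hyperbolaVelocity ν σ y)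
    (bound := fun y => K * ‖Complex.exp (hyperbola γ ν σ y * (t / 2 : ℝ)) *
      hyperbolaVelocity ν σ y‖)
    (Ioo_mem_nhds (by linarith) (by linarith))
    (Eventually.of_forall fun s => Continuous.aestronglyMeasurable (by fun_prop))
    (integrable_exp_sub_mul_inv_hyperbola_sub hν hσ ht ha)
    (Continuous.aestronglyMeasurable (by fun_prop))
    (ae_of_all _ fun y s hs => ?_)
    ((integrable_exp_mul_hyperbolaVelocity hν hσ (half_pos ht)).norm.const_mul K)
    (ae_of_all _ fun y s hs => ?_)).2
  · refine h.congr_deriv ?_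
    rw [← mul_zero (Complex.exp (-a * t)),
      ← integral_exp_mul_hyperbolaVelocity (γ := γ) hν hσ ht, ← integral_const_mul]
    congr 1 with y
    rw [sub_mul, sub_eq_neg_add, Complex.exp_add, neg_mul]
    ring
  · rw [norm_mul, norm_mul, norm_exp_hyperbola_sub_mul, norm_exp_hyperbola_mul, ← mul_assoc, hK,
      ← Real.exp_add]
    refine mul_le_mul_of_nonneg_right (Real.exp_le_exp.2 ?_) (norm_nonneg _)
    have hs0 : 0 < s := (half_pos ht).trans hs.1
    have h1 : (γ - a) * s ≤ |γ - a| * (2 * t) :=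
      mul_le_mul (le_abs_self _) hs.2.le hs0.le (abs_nonneg _)
    have h2 := mul_le_mul_of_nonneg_left hs.1.le (Real.sqrt_nonneg (ν ^ 2 + y ^ 2))
    have h3 := mul_le_mul_of_nonneg_right (neg_abs_le γ) (half_pos ht).le
    linarith
  · have h0 := hyperbola_sub_ne_zero hν hσ ha y
    have h1 : HasDerivAt (fun s : ℝ => (hyperbola γ ν σ y - a) * (s : ℂ))
        (hyperbola γ ν σ y - a) s := by
      simpa using ((hasDerivAt_id s).ofReal_comp).const_mul (hyperbola γ ν σ y - a)
    refine ((h1.cexp.mul_const (hyperbolaVelocity ν σ y)).mul_const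
      (hyperbola γ ν σ y - a)⁻¹).congr_deriv ?_
    field_simp

lemma exists_integral_exp_sub_mul_eq (hν : 0 < ν) (hσ : 0 < σ) {a : ℝ} (ha : γ - ν ≠ a) :
    ∃ C : ℂ, ∀ t : ℝ, 0 < t → ∫ y, Complex.exp ((hyperbola γ ν σ y - a) * t) *
      hyperbolaVelocity ν σ y * (hyperbola γ ν σ y - a)⁻¹ = C :=
  isOpen_Ioi.exists_is_const_of_deriv_eq_zero isPreconnected_Ioi
    (fun _ ht => (hasDerivAt_integral_exp_sub_mul hν hσ ht ha).differentiableAt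
      |>.differentiableWithinAt)
    (fun _ ht => (hasDerivAt_integral_exp_sub_mul hν hσ ht ha).deriv)

lemma integral_exp_mul_inv_hyperbola_sub_eq_exp_mul (a t : ℝ) :
    ∫ y, Complex.exp (hyperbola γ ν σ y * t) * hyperbolaVelocity ν σ y *
      (hyperbola γ ν σ y - a)⁻¹ =
    Complex.exp (a * t) * ∫ y, Complex.exp ((hyperbola γ ν σ y - a) * t) *
      hyperbolaVelocity ν σ y * (hyperbola γ ν σ y - a)⁻¹ := by
  rw [← integral_const_mul]
  congr 1 with y
  rw [← mul_assoc, ← mul_assoc, ← Complex.exp_add, sub_mul, add_sub_cancel]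

lemma integral_exp_mul_inv_hyperbola_sub_of_lt (hν : 0 < ν) (hσ : 0 < σ) {t : ℝ} (ht : 0 < t)
    {a : ℝ} (ha : γ - ν < a) :
    ∫ y, Complex.exp (hyperbola γ ν σ y * t) * hyperbolaVelocity ν σ y *
      (hyperbola γ ν σ y - a)⁻¹ = 0 := by
  have hz := continuous_hyperbola (γ := γ) (σ := σ) hν
  have hv := continuous_hyperbolaVelocity (σ := σ) hν
  have hi := continuous_inv_hyperbola_sub hν hσ ha.ne
  have hneg : ∀ y, γ - Real.sqrt (ν ^ 2 + y ^ 2) - a < 0 := fun y => by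
    linarith [le_sqrt_add_sq ν y]
  obtain ⟨C, hC⟩ := exists_integral_exp_sub_mul_eq (γ := γ) hν hσ ha.ne
  have hlim := tendsto_integral_filter_of_dominated_convergence (μ := volume) (l := atTop)
    (F := fun (s : ℝ) y => Complex.exp ((hyperbola γ ν σ y - a) * s) *
      hyperbolaVelocity ν σ y * (hyperbola γ ν σ y - a)⁻¹) (f := fun _ => 0)
    (fun y => ‖Complex.exp ((hyperbola γ ν σ y - a) * (1 : ℝ)) *
      hyperbolaVelocity ν σ y * (hyperbola γ ν σ y - a)⁻¹‖)
    (Eventually.of_forall fun s => Continuous.aestronglyMeasurable (by fun_prop))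
    ((eventually_ge_atTop 1).mono fun s hs => ae_of_all _ fun y => ?_)
    (integrable_exp_sub_mul_inv_hyperbola_sub hν hσ one_pos ha.ne).norm
    (ae_of_all _ fun y => ?_)
  · rw [integral_zero] at hlim
    have hC' := tendsto_nhds_unique (hlim.congr' ((eventually_gt_atTop 0).mono hC))
      tendsto_const_nhds
    rw [integral_exp_mul_inv_hyperbola_sub_eq_exp_mul, hC t ht, ← hC', mul_zero]
  · simp only [norm_mul, norm_exp_hyperbola_sub_mul]
    gcongr ?_ * _ * _
    exact Real.exp_le_exp.2 (mul_le_mul_of_nonpos_left hs (hneg y).le)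
  · have h0 : Tendsto (fun s : ℝ => Complex.exp ((hyperbola γ ν σ y - a) * s)) atTop (𝓝 0) := by
      rw [tendsto_zero_iff_norm_tendsto_zero]
      simp only [norm_exp_hyperbola_sub_mul]
      exact Real.tendsto_exp_atBot.comp (tendsto_id.const_mul_atTop_of_neg (hneg y))
    simpa using (h0.mul_const (hyperbolaVelocity ν σ y)).mul_const (hyperbola γ ν σ y - a)⁻¹

lemma exists_norm_inv_sub_inv_hyperbola_le (hν : 0 < ν) (hσ : 0 < σ) {a b : ℝ}
    (ha : γ - ν ≠ a) (hb : γ - ν ≠ b) :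
    ∃ K, ∀ y, ‖hyperbolaVelocity ν σ y *
      ((hyperbola γ ν σ y - a)⁻¹ - (hyperbola γ ν σ y - b)⁻¹)‖ ≤ K * (1 + y ^ 2)⁻¹ := by
  obtain ⟨m, hm, hma⟩ := exists_norm_hyperbola_sub_sq_ge hν hσ ha
  obtain ⟨n, hn, hnb⟩ := exists_norm_hyperbola_sub_sq_ge hν hσ hb
  refine ⟨(1 + σ) * (|a - b| * (m⁻¹ + n⁻¹)), fun y => ?_⟩
  have hp : 0 < 1 + y ^ 2 := by positivity
  have h1 := inv_anti₀ (by positivity) (hma y)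
  have h2 := inv_anti₀ (by positivity) (hnb y)
  rw [mul_inv, ← inv_pow] at h1 h2
  rw [inv_sub_inv (hyperbola_sub_ne_zero hν hσ ha y) (hyperbola_sub_ne_zero hν hσ hb y),
    sub_sub_sub_cancel_left, ← Complex.ofReal_sub, div_eq_mul_inv, mul_inv, mul_assoc]
  simp only [norm_mul, norm_inv, Complex.norm_real, Real.norm_eq_abs]
  refine mul_le_mul (norm_hyperbolaVelocity_le hν hσ y) ?_ (by positivity) (by positivity)
  rw [mul_assoc]
  refine mul_le_mul_of_nonneg_left ?_ (abs_nonneg _)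
  nlinarith [sq_nonneg (‖hyperbola γ ν σ y - a‖⁻¹ - ‖hyperbola γ ν σ y - b‖⁻¹),
    sq_nonneg (‖hyperbola γ ν σ y - a‖⁻¹), sq_nonneg (‖hyperbola γ ν σ y - b‖⁻¹)]

lemma hyperbola_moebius_im (a y : ℝ) :
    (-1 + ((γ - a : ℝ) : ℂ) * (γ - hyperbola γ ν σ y)⁻¹).im =
      (γ - a) * (σ * y / Complex.normSq (γ - hyperbola γ ν σ y)) := by
  rw [Complex.add_im, Complex.im_ofReal_mul, Complex.inv_im]
  simp

lemma tendsto_hyperbola_moebius (hσ : 0 < σ) (a : ℝ) :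
    Tendsto (fun y => -1 + ((γ - a : ℝ) : ℂ) * (γ - hyperbola γ ν σ y)⁻¹)
      (cocompact ℝ) (𝓝 (-1)) := by
  have h : Tendsto (fun y => (γ - hyperbola γ ν σ y)⁻¹) (cocompact ℝ) (𝓝 0) := by
    refine tendsto_inv₀_cobounded.comp (tendsto_norm_atTop_iff_cobounded.1 ?_)
    refine tendsto_atTop_mono (fun y => ?_)
      (tendsto_norm_cocompact_atTop.const_mul_atTop hσ)
    have := Complex.abs_im_le_norm (γ - hyperbola γ ν σ y)
    simpa [abs_mul, abs_of_pos hσ] using this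
  simpa using (h.const_mul ((γ - a : ℝ) : ℂ)).const_add (-1)

lemma integral_hyperbolaVelocity_mul_inv_sub_inv (hν : 0 < ν) (hσ : 0 < σ) {a : ℝ}
    (ha : a < γ - ν) :
    ∫ y, hyperbolaVelocity ν σ y * ((hyperbola γ ν σ y - a)⁻¹ - (hyperbola γ ν σ y - γ)⁻¹) =
      2 * Real.pi * Complex.I := by
  have hγ : γ - ν ≠ γ := by linarith
  have hz := continuous_hyperbola (γ := γ) (σ := σ) hν
  have hv := continuous_hyperbolaVelocity (σ := σ) hν
  have hia := continuous_inv_hyperbola_sub hν hσ ha.ne'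
  have hiγ := continuous_inv_hyperbola_sub hν hσ hγ
  have hγa : 0 < γ - a := by linarith
  have hne : ∀ y, (γ : ℂ) - hyperbola γ ν σ y ≠ 0 := fun y h =>
    hyperbola_sub_ne_zero hν hσ hγ y (by rw [← neg_sub, h, neg_zero])
  have hsq : ∀ y, 0 < Complex.normSq (γ - hyperbola γ ν σ y) := fun y =>
    Complex.normSq_pos.2 (hne y)
  set q : ℝ → ℂ := fun y => -1 + ((γ - a : ℝ) : ℂ) * (γ - hyperbola γ ν σ y)⁻¹ with hq
  have him : ∀ y, (q y).im = (γ - a) * (σ * y / Complex.normSq (γ - hyperbola γ ν σ y)) :=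
    hyperbola_moebius_im a
  have hslit : ∀ y, q y ∈ Complex.slitPlane := fun y => by
    rw [Complex.mem_slitPlane_iff]
    rcases eq_or_ne y 0 with rfl | hy
    · left
      have h0 : hyperbola γ ν σ 0 = ((γ - ν : ℝ) : ℂ) := by
        simp [hyperbola, Real.sqrt_sq hν.le]
      have : q 0 = ((-1 + (γ - a) * ν⁻¹ : ℝ) : ℂ) := by
        simp [hq, h0]
      rw [this, Complex.ofReal_re]
      have : 1 < (γ - a) * ν⁻¹ := by
        rw [← div_eq_mul_inv, one_lt_div hν]
        linarith
      linarith
    · right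
      rw [him]
      have := (hsq y).ne'
      positivity
  have hderiv : ∀ y, HasDerivAt (fun y => Complex.log (q y)) (hyperbolaVelocity ν σ y *
      ((hyperbola γ ν σ y - a)⁻¹ - (hyperbola γ ν σ y - γ)⁻¹)) y := fun y => by
    have h1 : HasDerivAt q _ y := ((((hasDerivAt_hyperbola (γ := γ) (σ := σ) hν y).const_sub
      (γ : ℂ)).inv (hne y)).const_mul ((γ - a : ℝ) : ℂ)).const_add (-1)
    refine (h1.clog_real (hslit y)).congr_deriv ?_
    have h2 := hne y
    have h3 := hyperbola_sub_ne_zero hν hσ ha.ne' y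
    have h4 := hyperbola_sub_ne_zero hν hσ hγ y
    have hqy : q y = (hyperbola γ ν σ y - a) * (γ - hyperbola γ ν σ y)⁻¹ := by
      simp only [hq]
      field_simp
      push_cast
      ring
    rw [hqy, ← neg_sub (γ : ℂ) (hyperbola γ ν σ y)]
    field_simp
    push_cast
    ring
  have hlim := tendsto_hyperbola_moebius (γ := γ) (ν := ν) hσ a
  have htop : Tendsto (fun y => Complex.log (q y)) atTop (𝓝 (Real.pi * Complex.I)) := by
    have h := (Complex.continuousWithinAt_log_of_re_neg_of_im_zero (z := -1)
      (by simp) (by simp)).tendsto.comp (tendsto_nhdsWithin_iff.2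
        ⟨hlim.mono_left atTop_le_cocompact, (eventually_ge_atTop 0).mono fun y hy => ?_⟩)
    · simpa [hq, Function.comp_def, Complex.log_neg_one] using h
    · change 0 ≤ (q y).im
      rw [him]
      have := hsq y
      positivity
  have hbot : Tendsto (fun y => Complex.log (q y)) atBot (𝓝 (-(Real.pi * Complex.I))) := by
    have h := (Complex.tendsto_log_nhdsWithin_im_neg_of_re_neg_of_im_zero (z := -1)
      (by simp) (by simp)).comp (tendsto_nhdsWithin_iff.2
        ⟨hlim.mono_left atBot_le_cocompact, (eventually_lt_atBot 0).mono fun y hy => ?_⟩)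
    · simpa [hq, Function.comp_def] using h
    · change (q y).im < 0
      rw [him]
      exact mul_neg_of_pos_of_neg hγa (div_neg_of_neg_of_pos (mul_neg_of_pos_of_neg hσ hy) (hsq y))
  obtain ⟨K, hK⟩ := exists_norm_inv_sub_inv_hyperbola_le (γ := γ) hν hσ ha.ne' hγ
  rw [integral_of_hasDerivAt_of_tendsto hderiv ((integrable_inv_one_add_sq.const_mul K).mono'
    (Continuous.aestronglyMeasurable (by fun_prop)) (ae_of_all _ hK)) hbot htop]
  ring

lemma integral_exp_mul_inv_hyperbola_sub_of_gt (hν : 0 < ν) (hσ : 0 < σ) {t : ℝ} (ht : 0 < t)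
    {a : ℝ} (ha : a < γ - ν) :
    ∫ y, Complex.exp (hyperbola γ ν σ y * t) * hyperbolaVelocity ν σ y *
      (hyperbola γ ν σ y - a)⁻¹ = 2 * Real.pi * Complex.I * Complex.exp (a * t) := by
  have hγ : γ - ν < γ := by linarith
  have hz := continuous_hyperbola (γ := γ) (σ := σ) hν
  have hv := continuous_hyperbolaVelocity (σ := σ) hν
  have hia := continuous_inv_hyperbola_sub hν hσ ha.ne'
  have hiγ := continuous_inv_hyperbola_sub hν hσ hγ.ne
  obtain ⟨C, hC⟩ := exists_integral_exp_sub_mul_eq (γ := γ) hν hσ ha.ne'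
  obtain ⟨K, hK⟩ := exists_norm_inv_sub_inv_hyperbola_le (γ := γ) hν hσ ha.ne' hγ.ne
  have hlim := tendsto_integral_filter_of_dominated_convergence (μ := volume) (l := 𝓝[>] (0 : ℝ))
    (F := fun (s : ℝ) y => Complex.exp (hyperbola γ ν σ y * s) * (hyperbolaVelocity ν σ y *
      ((hyperbola γ ν σ y - a)⁻¹ - (hyperbola γ ν σ y - γ)⁻¹)))
    (f := fun y => hyperbolaVelocity ν σ y *
      ((hyperbola γ ν σ y - a)⁻¹ - (hyperbola γ ν σ y - γ)⁻¹))
    (fun y => Real.exp |γ| * (K * (1 + y ^ 2)⁻¹))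
    (Eventually.of_forall fun s => Continuous.aestronglyMeasurable (by fun_prop))
    (mem_of_superset (Ioc_mem_nhdsGT one_pos) fun s hs => ae_of_all _ fun y => ?_)
    ((integrable_inv_one_add_sq.const_mul K).const_mul _)
    (ae_of_all _ fun y => ?_)
  · rw [integral_hyperbolaVelocity_mul_inv_sub_inv hν hσ ha] at hlim
    have hexp : Tendsto (fun s : ℝ => Complex.exp (a * s) * C) (𝓝[>] 0) (𝓝 C) := by
      have : Continuous fun s : ℝ => Complex.exp (a * s) * C := by fun_prop
      simpa using (this.tendsto 0).mono_left nhdsWithin_le_nhds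
    have hCeq := tendsto_nhds_unique hexp
      (hlim.congr' (eventually_mem_nhdsWithin.mono fun s (hs : 0 < s) => ?_))
    · rw [integral_exp_mul_inv_hyperbola_sub_eq_exp_mul, hC t ht, hCeq, mul_comm]
    · change _ = Complex.exp (a * s) * C
      have h1 := integral_sub (integrable_exp_mul_inv_hyperbola_sub (γ := γ) hν hσ hs ha.ne')
        (integrable_exp_mul_inv_hyperbola_sub hν hσ hs hγ.ne)
      rw [integral_exp_mul_inv_hyperbola_sub_of_lt hν hσ hs hγ, sub_zero,
        integral_exp_mul_inv_hyperbola_sub_eq_exp_mul, hC s hs] at h1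
      rw [← h1]
      congr 1 with y
      ring
  · rw [norm_mul, norm_exp_hyperbola_mul]
    refine mul_le_mul (Real.exp_le_exp.2 ?_) (hK y) (norm_nonneg _) (Real.exp_pos _).le
    have h1 : 0 ≤ Real.sqrt (ν ^ 2 + y ^ 2) * s := mul_nonneg (Real.sqrt_nonneg _) hs.1.le
    have h2 := mul_le_mul_of_nonneg_right (le_abs_self γ) hs.1.le
    have h3 := mul_le_mul_of_nonneg_left hs.2 (abs_nonneg γ)
    linarith
  · have : Continuous fun s : ℝ => Complex.exp (hyperbola γ ν σ y * s) * (hyperbolaVelocity ν σ y *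
      ((hyperbola γ ν σ y - a)⁻¹ - (hyperbola γ ν σ y - γ)⁻¹)) := by fun_prop
    simpa using (this.tendsto 0).mono_left nhdsWithin_le_nhds

end Hyperbola

lemma Orthonormal.norm_sum_smul_sq_s14 {𝕜 ι E : Type*} [RCLike 𝕜] [NormedAddCommGroup E]
    [InnerProductSpace 𝕜 E] {φ : ι → E} (hφ : Orthonormal 𝕜 φ) (l : ι → 𝕜) (s : Finset ι) :
    ‖∑ i ∈ s, l i • φ i‖ ^ 2 = ∑ i ∈ s, ‖l i‖ ^ 2 :=
  hφ.orthogonalFamily.norm_sum l s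

lemma Orthonormal.summable_smul {𝕜 ι E : Type*} [RCLike 𝕜] [NormedAddCommGroup E]
    [InnerProductSpace 𝕜 E] [CompleteSpace E] {φ : ι → E} (hφ : Orthonormal 𝕜 φ) {l : ι → 𝕜}
    (hl : Summable fun i => ‖l i‖ ^ 2) : Summable fun i => l i • φ i :=
  (hφ.orthogonalFamily.summable_iff_norm_sq_summable l).2 hl

lemma exists_pos_le_abs_sub_of_separated {u : ℕ → ℝ} (hu : Monotone u) {x : ℝ} {N : ℕ}
    (hleft : ∀ k < N, u k < x) (hright : ∀ k, N ≤ k → x < u k) :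
    ∃ d > 0, ∀ k, d ≤ |x - u k| := by
  refine ⟨min |x - u N| |x - u (N - 1)|, lt_min (abs_pos.2 ?_) (abs_pos.2 ?_), fun k => ?_⟩
  · exact sub_ne_zero.2 (hright N le_rfl).ne
  · rcases lt_or_ge (N - 1) N with h | h
    · exact sub_ne_zero.2 (hleft _ h).ne'
    · exact sub_ne_zero.2 (hright _ h).ne
  · rcases lt_or_ge k N with h | h
    · refine (min_le_right _ _).trans ?_
      rw [abs_of_pos (sub_pos.2 (hleft k h)), abs_of_pos (sub_pos.2 (hleft (N - 1) (by omega)))]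
      linarith [hu (show k ≤ N - 1 by omega)]
    · refine (min_le_left _ _).trans ?_
      rw [abs_of_neg (sub_neg.2 (hright k h)), abs_of_neg (sub_neg.2 (hright N le_rfl))]
      linarith [hu h]

/-- Spectral representation of the contour-integral regularized solution: if the
eigenvalues `λ_k` for `k < N` lie strictly to the left of the contour
`z(y) = γ − √(ν² + y²) + iσy` (i.e. `λ_k < γ − ν`) and all remaining eigenvalues
lie strictly to the right, and `v(z) = ∑_k c_k (z − λ_k)⁻¹ φ_k`, then for `t > 0`
the Bochner integral `(1/(2πi)) ∫ e^{z(y)t} v(z(y)) z′(y) dy` converges and equals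
`∑_{k<N} c_k e^{λ_k t} φ_k`. -/
theorem contour_integral_spectral_representation
    {H : Type*} [NormedAddCommGroup H] [InnerProductSpace ℂ H] [CompleteSpace H]
    (φ : ℕ → H) (hφ : Orthonormal ℂ φ)
    (lam : ℕ → ℝ) (hmono : Monotone lam) (hpos : ∀ k, 0 < lam k)
    (hto : Filter.Tendsto lam Filter.atTop Filter.atTop)
    (c : ℕ → ℂ) (hc : Summable (fun k => ‖c k‖ ^ 2))
    (γ ν σ : ℝ) (hν : 0 < ν) (hσ : 0 < σ)
    (N : ℕ) (hleft : ∀ k < N, lam k < γ - ν) (hright : ∀ k, N ≤ k → γ - ν < lam k)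
    (v : ℂ → H) (hv : ∀ z : ℂ, v z = ∑' k, (c k * (z - (lam k : ℂ))⁻¹) • φ k)
    (t : ℝ) (ht : 0 < t) :
    Integrable (fun y : ℝ =>
      (Complex.exp ((((γ - Real.sqrt (ν ^ 2 + y ^ 2) : ℝ) : ℂ) + Complex.I * σ * y) * t) *
          (((-(y / Real.sqrt (ν ^ 2 + y ^ 2)) : ℝ) : ℂ) + Complex.I * σ)) •
        v (((γ - Real.sqrt (ν ^ 2 + y ^ 2) : ℝ) : ℂ) + Complex.I * σ * y)) ∧
    (1 / (2 * Real.pi * Complex.I) : ℂ) •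
        ∫ y : ℝ,
          (Complex.exp ((((γ - Real.sqrt (ν ^ 2 + y ^ 2) : ℝ) : ℂ) + Complex.I * σ * y) * t) *
              (((-(y / Real.sqrt (ν ^ 2 + y ^ 2)) : ℝ) : ℂ) + Complex.I * σ)) •
            v (((γ - Real.sqrt (ν ^ 2 + y ^ 2) : ℝ) : ℂ) + Complex.I * σ * y) =
      ∑ k ∈ Finset.range N, (c k * Complex.exp ((lam k : ℂ) * t)) • φ k := by
  obtain ⟨d, hd, hdist⟩ := exists_pos_le_abs_sub_of_separated hmono hleft hright
  have hne : ∀ k, γ - ν ≠ lam k := fun k =>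
    sub_ne_zero.1 (abs_pos.1 (hd.trans_le (hdist k)))
  set r := (σ * d / (1 + σ))⁻¹ with hr
  have hr0 : 0 < r := by positivity
  set S : ℕ → ℝ → H := fun n y =>
    ∑ k ∈ Finset.range n, (c k * (hyperbola γ ν σ y - lam k)⁻¹) • φ k with hS
  set B := Real.sqrt (r ^ 2 * ∑' k, ‖c k‖ ^ 2) with hB
  have hcoef : ∀ k y, ‖c k * (hyperbola γ ν σ y - lam k)⁻¹‖ ^ 2 ≤ r ^ 2 * ‖c k‖ ^ 2 := by
    intro k y
    rw [norm_mul, mul_pow, mul_comm]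
    gcongr
    exact norm_inv_hyperbola_sub_le hν hσ hd (hdist k) y
  have hScont : ∀ n, Continuous (S n) := fun n =>
    continuous_finsetSum _ fun k _ =>
      (continuous_const.mul (continuous_inv_hyperbola_sub hν hσ (hne k))).smul continuous_const
  have hSbound : ∀ n y, ‖S n y‖ ≤ B := fun n y => by
    refine Real.le_sqrt_of_sq_le ?_
    rw [hS, hφ.norm_sum_smul_sq_s14, ← tsum_mul_left]
    exact (Finset.sum_le_sum fun k _ => hcoef k y).trans
      ((hc.mul_left _).sum_le_tsum _ fun k _ => by positivity)
  have hSlim : ∀ y, Tendsto (fun n => S n y) atTop (𝓝 (v (hyperbola γ ν σ y))) := fun y => by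
    rw [hv]
    exact (hφ.summable_smul (Summable.of_nonneg_of_le (fun k => by positivity)
      (fun k => hcoef k y) (hc.mul_left _))).hasSum.tendsto_sum_nat
  have hvmeas : AEStronglyMeasurable fun y => v (hyperbola γ ν σ y) :=
    aestronglyMeasurable_of_tendsto_ae _ (fun n => (hScont n).aestronglyMeasurable)
      (ae_of_all _ hSlim)
  have hvbound : ∀ y, ‖v (hyperbola γ ν σ y)‖ ≤ B := fun y =>
    le_of_tendsto (hSlim y).norm (Eventually.of_forall fun n => hSbound n y)
  refine ⟨integrable_exp_mul_hyperbolaVelocity_smul hν hσ ht hvmeas hvbound, ?_⟩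
  have hKint := integrable_exp_mul_hyperbolaVelocity (γ := γ) hν hσ ht
  have hlim := tendsto_integral_of_dominated_convergence (μ := volume)
    (F := fun n y =>
      (Complex.exp (hyperbola γ ν σ y * t) * hyperbolaVelocity ν σ y) • S n y)
    (f := fun y =>
      (Complex.exp (hyperbola γ ν σ y * t) * hyperbolaVelocity ν σ y) • v (hyperbola γ ν σ y))
    (fun y => ‖Complex.exp (hyperbola γ ν σ y * t) * hyperbolaVelocity ν σ y‖ * B)
    (fun n => hKint.aestronglyMeasurable.smul (hScont n).aestronglyMeasurable)
    (hKint.norm.mul_const B)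
    (fun n => ae_of_all _ fun y => by
      rw [norm_smul]
      exact mul_le_mul_of_nonneg_left (hSbound n y) (norm_nonneg _))
    (ae_of_all _ fun y => (hSlim y).const_smul _)
  have hpartial : ∀ n, N ≤ n →
      ∫ y, (Complex.exp (hyperbola γ ν σ y * t) * hyperbolaVelocity ν σ y) • S n y =
        (2 * Real.pi * Complex.I : ℂ) •
          ∑ k ∈ Finset.range N, (c k * Complex.exp ((lam k : ℂ) * t)) • φ k := by
    intro n hn
    have hexpand : ∀ y, (Complex.exp (hyperbola γ ν σ y * t) * hyperbolaVelocity ν σ y) • S n y =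
        ∑ k ∈ Finset.range n, (c k * (Complex.exp (hyperbola γ ν σ y * t) *
          hyperbolaVelocity ν σ y * (hyperbola γ ν σ y - lam k)⁻¹)) • φ k := fun y => by
      rw [hS, Finset.smul_sum]
      refine Finset.sum_congr rfl fun k _ => ?_
      rw [smul_smul, mul_left_comm]
    simp only [hexpand]
    rw [integral_finsetSum _ fun k _ => ((integrable_exp_mul_inv_hyperbola_sub hν hσ ht
      (hne k)).const_mul (c k)).smul_const (φ k), ← Finset.sum_subset
      (Finset.range_mono hn) fun k _ hk => ?_, Finset.smul_sum]
    · refine Finset.sum_congr rfl fun k hk => ?_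
      rw [integral_smul_const, integral_const_mul, integral_exp_mul_inv_hyperbola_sub_of_gt hν hσ ht
        (hleft k (Finset.mem_range.1 hk)), smul_smul, mul_left_comm]
    · rw [integral_smul_const, integral_const_mul, integral_exp_mul_inv_hyperbola_sub_of_lt hν hσ ht
        (hright k (by simpa using hk)), mul_zero, zero_smul]
  have hval := tendsto_nhds_unique hlim
    (tendsto_const_nhds.congr' ((eventually_ge_atTop N).mono fun n hn => (hpartial n hn).symm))
  refine (congrArg (fun x => (1 / (2 * Real.pi * Complex.I) : ℂ) • x) hval).trans ?_
  simp only [smul_smul]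
  rw [one_div_mul_cancel Complex.two_pi_I_ne_zero, one_smul]
end
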